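/- arXiv:2403.13984 — 3 statements merged into one kernel-verified Lean document; each statement's English description precedes it below -/
import Mathlib

section
/- There exists T₁ > T₀ := 2^(3/4)·π such that for every T ∈ (T₀, T₁) the Hamiltonian system (ham) admits a non-constant 2T-periodic solution (u_T, v_T, a_T, b_T); moreover, as T → T₀⁺ these solutions converge to the constant solution P₊ = (1, 0, 1/(2√2), 1/(2√2)), uniformly on compact subsets of ℝ together with their derivatives (up to order 2 for u_T, v_T and up to order 1 for a_T, b_T). -/
open Filter Topology

/-- `(u, v, a, b)` is a solution of system (ham):
`u' = v`, `v' = -(a² + b² - 1/4)·u`, `a' = -a + u²·b`, `b' = b - u²·a`. -/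
def IsHamSolution (u v a b : ℝ → ℝ) : Prop :=
  (∀ t, HasDerivAt u (v t) t) ∧
  (∀ t, HasDerivAt v (-((a t) ^ 2 + (b t) ^ 2 - 1 / 4) * u t) t) ∧
  (∀ t, HasDerivAt a (-(a t) + (u t) ^ 2 * b t) t) ∧
  (∀ t, HasDerivAt b (b t - (u t) ^ 2 * a t) t)

section FixedPoint

/-- A `C¹` family of self-maps of a Banach space that is constant at parameter `0` has a continuous
family of fixed points for small parameters. -/
lemma exists_continuousOn_fixedPoint {E : Type*} [NormedAddCommGroup E] [NormedSpace ℝ E]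
    [CompleteSpace E] (Ψ : ℝ × E → E) (hΨ : ContDiff ℝ 1 Ψ) (e₀ : E) (h0 : ∀ e, Ψ (0, e) = e₀) :
    ∃ δ > 0, ∃ φ : ℝ → E, ContinuousOn φ (Set.Icc 0 δ) ∧ φ 0 = e₀ ∧
      ∀ ε ∈ Set.Icc 0 δ, φ ε = Ψ (ε, φ ε) := by
  have hF : ContDiff ℝ 1 fun p : ℝ × E => p.2 - Ψ p := contDiff_snd.sub hΨ
  have hFa : ContDiffAt ℝ 1 (fun p : ℝ × E => p.2 - Ψ p) (0, e₀) := hF.contDiffAt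
  have hd : fderiv ℝ (fun p : ℝ × E => p.2 - Ψ p) (0, e₀) ∘L ContinuousLinearMap.inr ℝ ℝ E
      = ContinuousLinearMap.id ℝ E := by
    have h1 : HasFDerivAt (fun e : E => e - Ψ (0, e))
        (fderiv ℝ (fun p : ℝ × E => p.2 - Ψ p) (0, e₀) ∘L ContinuousLinearMap.inr ℝ ℝ E) e₀ :=
      HasFDerivAt.comp (g := fun p : ℝ × E => p.2 - Ψ p) e₀
        (hF.differentiable one_ne_zero _).hasFDerivAt
        (hasFDerivAt_prodMk_right (0 : ℝ) e₀)
    have h2 : HasFDerivAt (fun e : E => e - Ψ (0, e)) (ContinuousLinearMap.id ℝ E) e₀ := by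
      simp only [h0]
      exact (hasFDerivAt_id e₀).sub_const e₀
    exact h1.unique h2
  have hinv : (fderiv ℝ (fun p : ℝ × E => p.2 - Ψ p) (0, e₀) ∘L
      ContinuousLinearMap.inr ℝ ℝ E).IsInvertible := by
    rw [hd]
    exact ⟨ContinuousLinearEquiv.refl ℝ E, rfl⟩
  set φ := hFa.implicitFunction one_ne_zero hinv with hφ
  have hφ0 : φ 0 = e₀ := hFa.implicitFunction_apply_self one_ne_zero hinv
  have hsol := hFa.eventually_apply_implicitFunction one_ne_zero hinv
  have hcont : ∀ᶠ x in 𝓝 (0 : ℝ), ContDiffAt ℝ 1 φ x :=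
    (hFa.contDiffAt_implicitFunction one_ne_zero hinv).eventually (by simp)
  obtain ⟨r, hr, hball⟩ := Metric.eventually_nhds_iff.1 (hsol.and hcont)
  have hmem : ∀ ε ∈ Set.Icc 0 (r / 2), dist ε 0 < r := by
    intro ε hε
    rw [Real.dist_eq, sub_zero, abs_of_nonneg hε.1]
    linarith [hε.2]
  refine ⟨r / 2, by positivity, φ, fun ε hε => ?_, hφ0, fun ε hε => ?_⟩
  · exact (hball (hmem ε hε)).2.continuousAt.continuousWithinAt
  · have := (hball (hmem ε hε)).1
    simp only [h0, sub_self] at this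
    exact sub_eq_zero.1 this

end FixedPoint

section HalfPeriod

/-- Continuous functions on the half period `[0, π]`. -/
abbrev HalfPeriodFun := C(Set.Icc (0 : ℝ) Real.pi, ℝ)

namespace HalfPeriodFun

/-- Extension of a function on `[0, π]` to the line, constant outside `[0, π]`. -/
noncomputable def ext (f : HalfPeriodFun) (t : ℝ) : ℝ := f (Set.projIcc 0 Real.pi Real.pi_nonneg t)

/-- Restriction to `[0, π]` of a continuous function on the line. -/
def res (g : ℝ → ℝ) (hg : Continuous g) : HalfPeriodFun := ⟨fun t => g t, by fun_prop⟩

lemma continuous_ext (f : HalfPeriodFun) : Continuous f.ext :=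
  f.continuous.comp continuous_projIcc

lemma ext_res {g : ℝ → ℝ} (hg : Continuous g) {t : ℝ} (ht : t ∈ Set.Icc 0 Real.pi) :
    (res g hg).ext t = g t := by
  simp [ext, res, Set.projIcc_of_mem _ ht]

lemma abs_ext_le (f : HalfPeriodFun) (t : ℝ) : |f.ext t| ≤ ‖f‖ := f.norm_coe_le_norm _

@[simp] lemma ext_add (f g : HalfPeriodFun) (t : ℝ) : (f + g).ext t = f.ext t + g.ext t := rfl
@[simp] lemma ext_sub (f g : HalfPeriodFun) (t : ℝ) : (f - g).ext t = f.ext t - g.ext t := rfl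
@[simp] lemma ext_mul (f g : HalfPeriodFun) (t : ℝ) : (f * g).ext t = f.ext t * g.ext t := rfl
@[simp] lemma ext_neg (f : HalfPeriodFun) (t : ℝ) : (-f).ext t = -f.ext t := rfl
@[simp] lemma ext_smul (r : ℝ) (f : HalfPeriodFun) (t : ℝ) : (r • f).ext t = r * f.ext t := rfl
@[simp] lemma ext_one (t : ℝ) : (1 : HalfPeriodFun).ext t = 1 := rfl
@[simp] lemma ext_zero (t : ℝ) : (0 : HalfPeriodFun).ext t = 0 := rfl

/-- The primitive `t ↦ ∫₀ᵗ f` as a continuous linear operator. -/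
noncomputable def prim : HalfPeriodFun →L[ℝ] HalfPeriodFun :=
  LinearMap.mkContinuous
    { toFun := fun f => res (fun t => ∫ s in (0 : ℝ)..t, f.ext s)
        (intervalIntegral.continuous_primitive
          (fun a b => f.continuous_ext.intervalIntegrable a b) 0)
      map_add' := fun f g => by
        ext t
        exact intervalIntegral.integral_add (f.continuous_ext.intervalIntegrable _ _)
          (g.continuous_ext.intervalIntegrable _ _)
      map_smul' := fun r f => by
        ext t
        exact intervalIntegral.integral_const_mul r f.ext } Real.pi fun f => by
    refine (ContinuousMap.norm_le _ (by positivity)).2 fun t => ?_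
    have h := intervalIntegral.norm_integral_le_of_norm_le_const (a := 0) (b := (t : ℝ))
      (f := f.ext) (C := ‖f‖) fun x _ => f.abs_ext_le x
    refine h.trans ?_
    rw [sub_zero, abs_of_nonneg t.2.1, mul_comm]
    gcongr
    exact t.2.2

lemma ext_prim (f : HalfPeriodFun) {t : ℝ} (ht : t ∈ Set.Icc 0 Real.pi) :
    (prim f).ext t = ∫ s in (0 : ℝ)..t, f.ext s := by
  simp [prim, ext_res _ ht]

/-- `F` has derivative `f` on `[0, π]`. -/
def HasDeriv (F f : HalfPeriodFun) : Prop :=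
  ∀ t ∈ Set.Icc 0 Real.pi, HasDerivWithinAt F.ext (f.ext t) (Set.Icc 0 Real.pi) t

namespace HasDeriv

variable {F f G g : HalfPeriodFun}

lemma add (hF : HasDeriv F f) (hG : HasDeriv G g) : HasDeriv (F + G) (f + g) :=
  fun t ht => (hF t ht).add (hG t ht)

lemma sub (hF : HasDeriv F f) (hG : HasDeriv G g) : HasDeriv (F - G) (f - g) :=
  fun t ht => (hF t ht).sub (hG t ht)

lemma neg (hF : HasDeriv F f) : HasDeriv (-F) (-f) :=
  fun t ht => (hF t ht).neg

lemma mul (hF : HasDeriv F f) (hG : HasDeriv G g) : HasDeriv (F * G) (f * G + F * g) :=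
  fun t ht => (hF t ht).mul (hG t ht)

lemma smul (r : ℝ) (hF : HasDeriv F f) : HasDeriv (r • F) (r • f) :=
  fun t ht => (hF t ht).const_mul r

lemma congr_deriv (hF : HasDeriv F f) (h : ∀ t ∈ Set.Icc 0 Real.pi, f.ext t = g.ext t) :
    HasDeriv F g :=
  fun t ht => h t ht ▸ hF t ht

lemma integral_eq (hF : HasDeriv F f) {t : ℝ} (ht : t ∈ Set.Icc 0 Real.pi) :
    F.ext t - F.ext 0 = ∫ s in (0 : ℝ)..t, f.ext s := by
  refine (intervalIntegral.integral_eq_sub_of_hasDeriv_right_of_le ht.1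
    F.continuous_ext.continuousOn (fun s hs => ?_) (f.continuous_ext.intervalIntegrable _ _)).symm
  have hs' : s ∈ Set.Ioo 0 Real.pi := ⟨hs.1, hs.2.trans_le ht.2⟩
  exact ((hF s ⟨hs'.1.le, hs'.2.le⟩).hasDerivAt (Icc_mem_nhds hs'.1 hs'.2)).hasDerivWithinAt

end HasDeriv

lemma hasDeriv_res {g g' : ℝ → ℝ} (hg : Continuous g) (hg' : Continuous g')
    (h : ∀ t, HasDerivAt g (g' t) t) : HasDeriv (res g hg) (res g' hg') := by
  intro t ht
  rw [ext_res _ ht]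
  exact (h t).hasDerivWithinAt.congr (fun s hs => ext_res _ hs) (ext_res _ ht)

lemma hasDeriv_prim (f : HalfPeriodFun) : HasDeriv (prim f) f := by
  intro t ht
  exact (intervalIntegral.integral_hasDerivAt_right (f.continuous_ext.intervalIntegrable _ _)
    (f.continuous_ext.stronglyMeasurableAtFilter _ _)
      f.continuous_ext.continuousAt).hasDerivWithinAt.congr
    (fun s hs => ext_prim f hs) (ext_prim f ht)

lemma ext_prim_zero (f : HalfPeriodFun) : (prim f).ext 0 = 0 := by
  rw [ext_prim f ⟨le_rfl, Real.pi_nonneg⟩, intervalIntegral.integral_same]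

end HalfPeriodFun

end HalfPeriod

section LinearProblem

namespace HalfPeriodFun

/-- Evaluation at the right end point `π`. -/
noncomputable def evalPi : HalfPeriodFun →L[ℝ] ℝ :=
  ContinuousMap.evalCLM ℝ (⟨Real.pi, Real.pi_nonneg, le_rfl⟩ : Set.Icc (0 : ℝ) Real.pi)

lemma evalPi_apply (f : HalfPeriodFun) : evalPi f = f.ext Real.pi := by
  simp [evalPi, ext]

/-- `cos` on `[0, π]`. -/
noncomputable def cosFun : HalfPeriodFun := res Real.cos Real.continuous_cos
/-- `sin` on `[0, π]`. -/
noncomputable def sinFun : HalfPeriodFun := res Real.sin Real.continuous_sin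
/-- `cosh` on `[0, π]`. -/
noncomputable def coshFun : HalfPeriodFun := res Real.cosh Real.continuous_cosh
/-- `sinh` on `[0, π]`. -/
noncomputable def sinhFun : HalfPeriodFun := res Real.sinh Real.continuous_sinh

lemma ext_cosFun {t : ℝ} (ht : t ∈ Set.Icc 0 Real.pi) : cosFun.ext t = Real.cos t := ext_res _ ht
lemma ext_sinFun {t : ℝ} (ht : t ∈ Set.Icc 0 Real.pi) : sinFun.ext t = Real.sin t := ext_res _ ht
lemma ext_coshFun {t : ℝ} (ht : t ∈ Set.Icc 0 Real.pi) : coshFun.ext t = Real.cosh t :=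
  ext_res _ ht
lemma ext_sinhFun {t : ℝ} (ht : t ∈ Set.Icc 0 Real.pi) : sinhFun.ext t = Real.sinh t :=
  ext_res _ ht

lemma sinFun_sq_add_cosFun_sq {t : ℝ} (ht : t ∈ Set.Icc 0 Real.pi) :
    sinFun.ext t ^ 2 + cosFun.ext t ^ 2 = 1 := by
  rw [ext_cosFun ht, ext_sinFun ht, Real.sin_sq_add_cos_sq]

lemma coshFun_sq_sub_sinhFun_sq {t : ℝ} (ht : t ∈ Set.Icc 0 Real.pi) :
    coshFun.ext t ^ 2 - sinhFun.ext t ^ 2 = 1 := by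
  rw [ext_coshFun ht, ext_sinhFun ht, Real.cosh_sq]
  ring

lemma hasDeriv_cosFun : HasDeriv cosFun (-sinFun) :=
  hasDeriv_res Real.continuous_cos Real.continuous_sin.neg Real.hasDerivAt_cos
lemma hasDeriv_sinFun : HasDeriv sinFun cosFun :=
  hasDeriv_res Real.continuous_sin Real.continuous_cos Real.hasDerivAt_sin
lemma hasDeriv_coshFun : HasDeriv coshFun sinhFun :=
  hasDeriv_res Real.continuous_cosh Real.continuous_sinh Real.hasDerivAt_cosh
lemma hasDeriv_sinhFun : HasDeriv sinhFun coshFun :=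
  hasDeriv_res Real.continuous_sinh Real.continuous_cosh Real.hasDerivAt_sinh

lemma zero_mem : (0 : ℝ) ∈ Set.Icc 0 Real.pi := ⟨le_rfl, Real.pi_nonneg⟩
lemma pi_mem : Real.pi ∈ Set.Icc 0 Real.pi := ⟨Real.pi_nonneg, le_rfl⟩

/-- First component of the solution of `P' = p + h`, `p' = -P + k`, `P(0) = p(0) = 0`. -/
noncomputable def rotPos (h k : HalfPeriodFun) : HalfPeriodFun :=
  cosFun * prim (cosFun * h - sinFun * k) + sinFun * prim (sinFun * h + cosFun * k)

/-- Second component of the solution of `P' = p + h`, `p' = -P + k`, `P(0) = p(0) = 0`. -/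
noncomputable def rotVel (h k : HalfPeriodFun) : HalfPeriodFun :=
  cosFun * prim (sinFun * h + cosFun * k) - sinFun * prim (cosFun * h - sinFun * k)

lemma hasDeriv_rotPos (h k : HalfPeriodFun) : HasDeriv (rotPos h k) (rotVel h k + h) := by
  refine ((hasDeriv_cosFun.mul (hasDeriv_prim _)).add
    (hasDeriv_sinFun.mul (hasDeriv_prim _))).congr_deriv fun t ht => ?_
  simp only [rotVel, ext_add, ext_sub, ext_mul, ext_neg]
  linear_combination h.ext t * sinFun_sq_add_cosFun_sq ht

lemma hasDeriv_rotVel (h k : HalfPeriodFun) : HasDeriv (rotVel h k) (-rotPos h k + k) := by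
  refine ((hasDeriv_cosFun.mul (hasDeriv_prim _)).sub
    (hasDeriv_sinFun.mul (hasDeriv_prim _))).congr_deriv fun t ht => ?_
  simp only [rotPos, ext_add, ext_sub, ext_mul, ext_neg]
  linear_combination k.ext t * sinFun_sq_add_cosFun_sq ht

lemma rotVel_zero (h k : HalfPeriodFun) : (rotVel h k).ext 0 = 0 := by
  simp [rotVel, ext_prim_zero]

lemma rotVel_pi {h k : HalfPeriodFun} (hk : evalPi (prim (sinFun * h + cosFun * k)) = 0) :
    (rotVel h k).ext Real.pi = 0 := by
  rw [evalPi_apply] at hk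
  simp only [rotVel, ext_sub, ext_mul, hk, ext_sinFun pi_mem, Real.sin_pi]
  ring

/-- The initial value `Q(0)` for which `Q' = q + h`, `q' = Q + l`, `q(0) = 0` has `q(π) = 0`. -/
noncomputable def hypInit (h l : HalfPeriodFun) : ℝ :=
  -(evalPi (prim (coshFun * h - sinhFun * l)) +
    Real.cosh Real.pi / Real.sinh Real.pi * evalPi (prim (coshFun * l - sinhFun * h)))

/-- First component of the solution of `Q' = q + h`, `q' = Q + l`, `q(0) = q(π) = 0`. -/
noncomputable def hypPos (h l : HalfPeriodFun) : HalfPeriodFun :=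
  hypInit h l • coshFun + coshFun * prim (coshFun * h - sinhFun * l) +
    sinhFun * prim (coshFun * l - sinhFun * h)

/-- Second component of the solution of `Q' = q + h`, `q' = Q + l`, `q(0) = q(π) = 0`. -/
noncomputable def hypVel (h l : HalfPeriodFun) : HalfPeriodFun :=
  hypInit h l • sinhFun + sinhFun * prim (coshFun * h - sinhFun * l) +
    coshFun * prim (coshFun * l - sinhFun * h)

lemma hasDeriv_hypPos (h l : HalfPeriodFun) : HasDeriv (hypPos h l) (hypVel h l + h) := by
  refine (((hasDeriv_coshFun.smul _).add (hasDeriv_coshFun.mul (hasDeriv_prim _))).add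
    (hasDeriv_sinhFun.mul (hasDeriv_prim _))).congr_deriv fun t ht => ?_
  simp only [hypVel, ext_add, ext_sub, ext_mul, ext_smul]
  linear_combination h.ext t * coshFun_sq_sub_sinhFun_sq ht

lemma hasDeriv_hypVel (h l : HalfPeriodFun) : HasDeriv (hypVel h l) (hypPos h l + l) := by
  refine (((hasDeriv_sinhFun.smul _).add (hasDeriv_sinhFun.mul (hasDeriv_prim _))).add
    (hasDeriv_coshFun.mul (hasDeriv_prim _))).congr_deriv fun t ht => ?_
  simp only [hypPos, ext_add, ext_sub, ext_mul, ext_smul]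
  linear_combination l.ext t * coshFun_sq_sub_sinhFun_sq ht

lemma hypVel_zero (h l : HalfPeriodFun) : (hypVel h l).ext 0 = 0 := by
  simp [hypVel, ext_prim_zero, ext_sinhFun zero_mem]

lemma hypVel_pi (h l : HalfPeriodFun) : (hypVel h l).ext Real.pi = 0 := by
  have hs : Real.sinh Real.pi ≠ 0 := (Real.sinh_pos_iff.2 Real.pi_pos).ne'
  simp only [hypVel, hypInit, evalPi_apply, ext_add, ext_mul, ext_smul, ext_sinhFun pi_mem,
    ext_coshFun pi_mem]
  field_simp
  ring

variable {X : Type*} [NormedAddCommGroup X] [NormedSpace ℝ X] {f g h : X → HalfPeriodFun}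

lemma contDiff_prim (hf : ContDiff ℝ 1 f) : ContDiff ℝ 1 fun x => prim (f x) :=
  prim.contDiff.comp hf

lemma contDiff_evalPi (hf : ContDiff ℝ 1 f) : ContDiff ℝ 1 fun x => evalPi (f x) :=
  evalPi.contDiff.comp hf

lemma contDiff_rotPos (hf : ContDiff ℝ 1 f) (hg : ContDiff ℝ 1 g) :
    ContDiff ℝ 1 fun x => rotPos (f x) (g x) :=
  (contDiff_const.mul (contDiff_prim ((contDiff_const.mul hf).sub (contDiff_const.mul hg)))).add
    (contDiff_const.mul (contDiff_prim ((contDiff_const.mul hf).add (contDiff_const.mul hg))))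

lemma contDiff_rotVel (hf : ContDiff ℝ 1 f) (hg : ContDiff ℝ 1 g) :
    ContDiff ℝ 1 fun x => rotVel (f x) (g x) :=
  (contDiff_const.mul (contDiff_prim ((contDiff_const.mul hf).add (contDiff_const.mul hg)))).sub
    (contDiff_const.mul (contDiff_prim ((contDiff_const.mul hf).sub (contDiff_const.mul hg))))

lemma contDiff_hypInit (hf : ContDiff ℝ 1 f) (hg : ContDiff ℝ 1 g) :
    ContDiff ℝ 1 fun x => hypInit (f x) (g x) :=
  ((contDiff_evalPi (contDiff_prim ((contDiff_const.mul hf).sub (contDiff_const.mul hg)))).add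
    (contDiff_const.mul (contDiff_evalPi
      (contDiff_prim ((contDiff_const.mul hg).sub (contDiff_const.mul hf)))))).neg

lemma contDiff_hypPos (hf : ContDiff ℝ 1 f) (hg : ContDiff ℝ 1 g) :
    ContDiff ℝ 1 fun x => hypPos (f x) (g x) :=
  (((contDiff_hypInit hf hg).smul contDiff_const).add
    (contDiff_const.mul (contDiff_prim ((contDiff_const.mul hf).sub (contDiff_const.mul hg))))).add
    (contDiff_const.mul (contDiff_prim ((contDiff_const.mul hg).sub (contDiff_const.mul hf))))

lemma contDiff_hypVel (hf : ContDiff ℝ 1 f) (hg : ContDiff ℝ 1 g) :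
    ContDiff ℝ 1 fun x => hypVel (f x) (g x) :=
  (((contDiff_hypInit hf hg).smul contDiff_const).add
    (contDiff_const.mul (contDiff_prim ((contDiff_const.mul hf).sub (contDiff_const.mul hg))))).add
    (contDiff_const.mul (contDiff_prim ((contDiff_const.mul hg).sub (contDiff_const.mul hf))))

/-- Solution `(r₁, r₂, r₃, r₄)` of the linear boundary value problem `r₁' = r₂`, `r₂' = -r₃ - f`,
`r₃' = r₄ + h`, `r₄' = -r₁ - g` with `r₂ = r₄ = 0` at `0` and `π`, obtained by decoupling
`r₁ ± r₃`. -/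
noncomputable def linSol (f g h : HalfPeriodFun) :
    HalfPeriodFun × HalfPeriodFun × HalfPeriodFun × HalfPeriodFun :=
  ((1 / 2 : ℝ) • (rotPos h (-(f + g)) + hypPos (-h) (g - f)),
    (1 / 2 : ℝ) • (rotVel h (-(f + g)) + hypVel (-h) (g - f)),
    (1 / 2 : ℝ) • (rotPos h (-(f + g)) - hypPos (-h) (g - f)),
    (1 / 2 : ℝ) • (rotVel h (-(f + g)) - hypVel (-h) (g - f)))

lemma contDiff_linSol (hf : ContDiff ℝ 1 f) (hg : ContDiff ℝ 1 g) (hh : ContDiff ℝ 1 h) :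
    ContDiff ℝ 1 fun x => linSol (f x) (g x) (h x) := by
  have hk := (hf.add hg).neg
  have hl := hg.sub hf
  exact (((contDiff_rotPos hh hk).add (contDiff_hypPos hh.neg hl)).const_smul _).prodMk
    ((((contDiff_rotVel hh hk).add (contDiff_hypVel hh.neg hl)).const_smul _).prodMk
    ((((contDiff_rotPos hh hk).sub (contDiff_hypPos hh.neg hl)).const_smul _).prodMk
    (((contDiff_rotVel hh hk).sub (contDiff_hypVel hh.neg hl)).const_smul _)))

lemma linSol_spec (f g h : HalfPeriodFun) :
    HasDeriv (linSol f g h).1 (linSol f g h).2.1 ∧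
    HasDeriv (linSol f g h).2.1 (-(linSol f g h).2.2.1 - f) ∧
    HasDeriv (linSol f g h).2.2.1 ((linSol f g h).2.2.2 + h) ∧
    HasDeriv (linSol f g h).2.2.2 (-(linSol f g h).1 - g) := by
  have hP := hasDeriv_rotPos h (-(f + g))
  have hp := hasDeriv_rotVel h (-(f + g))
  have hQ := hasDeriv_hypPos (-h) (g - f)
  have hq := hasDeriv_hypVel (-h) (g - f)
  refine ⟨((hP.add hQ).smul _).congr_deriv fun t _ => ?_,
    ((hp.add hq).smul _).congr_deriv fun t _ => ?_,
    ((hP.sub hQ).smul _).congr_deriv fun t _ => ?_,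
    ((hp.sub hq).smul _).congr_deriv fun t _ => ?_⟩ <;>
  simp only [linSol, ext_add, ext_sub, ext_neg, ext_smul] <;> ring

lemma linSol_zero (f g h : HalfPeriodFun) :
    (linSol f g h).2.1.ext 0 = 0 ∧ (linSol f g h).2.2.2.ext 0 = 0 := by
  simp [linSol, rotVel_zero, hypVel_zero]

lemma linSol_pi {f g h : HalfPeriodFun}
    (hs : evalPi (prim (sinFun * h - cosFun * (f + g))) = 0) :
    (linSol f g h).2.1.ext Real.pi = 0 ∧ (linSol f g h).2.2.2.ext Real.pi = 0 := by
  have : (rotVel h (-(f + g))).ext Real.pi = 0 := by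
    apply rotVel_pi
    rwa [mul_neg, ← sub_eq_add_neg]
  simp only [linSol, ext_smul, ext_add, ext_sub, this, hypVel_pi]
  norm_num

end HalfPeriodFun

end LinearProblem

section Branch

namespace HalfPeriodFun

/-- Second order coefficient of `u` along the branch. -/
noncomputable def secondU : HalfPeriodFun :=
  (-(1 / 4 + √2) : ℝ) • 1 + (3 / 20 + √2 / 5 : ℝ) • (cosFun * cosFun - sinFun * sinFun)

/-- Second order coefficient of `u'` along the branch. -/
noncomputable def secondV : HalfPeriodFun :=
  (-4 * (3 / 20 + √2 / 5) : ℝ) • (sinFun * cosFun)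

/-- Second order coefficient of the rescaled `a + b` along the branch. -/
noncomputable def secondS : HalfPeriodFun :=
  (-(√2 / 2 + 3 / 4) : ℝ) • 1 + (7 / 20 + 3 * √2 / 10 : ℝ) • (cosFun * cosFun - sinFun * sinFun)

/-- Second order coefficient of the rescaled `b - a` along the branch. -/
noncomputable def secondD : HalfPeriodFun :=
  (-(2 / 5 + 6 * √2 / 5) : ℝ) • (sinFun * cosFun)

lemma hasDeriv_const (r : ℝ) : HasDeriv (r • 1) 0 :=
  fun t _ => by
    have h : (r • (1 : HalfPeriodFun)).ext = fun _ => r := by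
      funext s
      simp
    rw [h]
    exact hasDerivWithinAt_const t _ r

lemma hasDeriv_cos_two : HasDeriv (cosFun * cosFun - sinFun * sinFun)
    ((-4 : ℝ) • (sinFun * cosFun)) := by
  refine ((hasDeriv_cosFun.mul hasDeriv_cosFun).sub
    (hasDeriv_sinFun.mul hasDeriv_sinFun)).congr_deriv fun t _ => ?_
  simp only [ext_add, ext_sub, ext_neg, ext_smul, ext_mul]
  ring

lemma hasDeriv_secondU : HasDeriv secondU secondV := by
  refine ((hasDeriv_const _).add (hasDeriv_cos_two.smul _)).congr_deriv fun t _ => ?_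
  simp only [secondV, ext_add, ext_smul, ext_mul, ext_zero]
  ring

lemma hasDeriv_secondV : HasDeriv secondV
    (-(secondS + (√2 + 1) • (cosFun * cosFun) + (1 / 2 : ℝ) • (sinFun * sinFun))) := by
  refine ((hasDeriv_sinFun.mul hasDeriv_cosFun).smul _).congr_deriv fun t ht => ?_
  simp only [secondS, ext_add, ext_sub, ext_neg, ext_smul, ext_mul, ext_one]
  linear_combination (√2 / 2 + 3 / 4) * sinFun_sq_add_cosFun_sq ht

lemma hasDeriv_secondS : HasDeriv secondS (secondD - sinFun * cosFun) := by
  refine ((hasDeriv_const _).add (hasDeriv_cos_two.smul _)).congr_deriv fun t _ => ?_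
  simp only [secondD, ext_add, ext_sub, ext_smul, ext_mul, ext_zero]
  ring

lemma hasDeriv_secondD : HasDeriv secondD
    (-(secondU + (1 / 2 + 2 * √2) • (cosFun * cosFun))) := by
  refine ((hasDeriv_sinFun.mul hasDeriv_cosFun).smul _).congr_deriv fun t ht => ?_
  simp only [secondU, ext_add, ext_sub, ext_neg, ext_smul, ext_mul, ext_one]
  linear_combination (1 / 4 + √2) * sinFun_sq_add_cosFun_sq ht

/-- Third order remainder of `(μ (ζ + √2 ζ²) + ω² / 2) (1 + x)` at
`x = ε cos + ε² X`, `ζ = ε cos + ε² Z`, `ω = -ε sin + ε² W`, `μ = 1 + ε² m`, without its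
term `m cos`. -/
noncomputable def remF (ε m : ℝ) (X Z W : HalfPeriodFun) : HalfPeriodFun :=
  (ε * m) • (Z + (cosFun + ε • Z) * (√2 • (cosFun + ε • Z) + (cosFun + ε • X) +
      (√2 * ε) • ((cosFun + ε • Z) * (cosFun + ε • X)))) +
    √2 • ((2 : ℝ) • (cosFun * Z) + ε • (Z * Z)) +
    (1 / 2 : ℝ) • ((-2 : ℝ) • (sinFun * W) + ε • (W * W)) +
    (cosFun + ε • X) * (√2 • ((cosFun + ε • Z) * (cosFun + ε • Z)) +
      (1 / 2 : ℝ) • ((ε • W - sinFun) * (ε • W - sinFun))) +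
    (cosFun * X + cosFun * Z + ε • (X * Z))

/-- Third order remainder of `μ (x + x² / 2) (1 + 2 √2 ζ)`, without its term `m cos`. -/
noncomputable def remG (ε m : ℝ) (X Z : HalfPeriodFun) : HalfPeriodFun :=
  (ε * m) • (X + (cosFun + ε • X) * ((1 / 2 : ℝ) • (cosFun + ε • X) +
      (2 * √2) • (cosFun + ε • Z) + (√2 * ε) • ((cosFun + ε • X) * (cosFun + ε • Z)))) +
    (1 / 2 : ℝ) • ((2 : ℝ) • (cosFun * X) + ε • (X * X)) +
    (2 * √2) • (cosFun * X + cosFun * Z + ε • (X * Z)) +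
    √2 • ((cosFun + ε • X) * (cosFun + ε • X) * (cosFun + ε • Z))

/-- Third order remainder of `(1 + x + x² / 2) ω`. -/
noncomputable def remH (ε : ℝ) (X W : HalfPeriodFun) : HalfPeriodFun :=
  cosFun * W - sinFun * X + ε • (X * W) +
    (1 / 2 : ℝ) • ((cosFun + ε • X) * (cosFun + ε • X) * (ε • W - sinFun))

/-- The correction of the period for which the linear problem is solvable. -/
noncomputable def periodCoeff (f g h : HalfPeriodFun) : ℝ :=
  1 / Real.pi * evalPi (prim (sinFun * h - cosFun * (f + g)))

lemma evalPi_prim_cos_sq : evalPi (prim (cosFun * cosFun)) = Real.pi / 2 := by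
  rw [evalPi_apply, ext_prim _ pi_mem]
  have h : HasDeriv ((1 / 2 : ℝ) • (sinFun * cosFun + res id continuous_id))
      (cosFun * cosFun) := by
    refine (((hasDeriv_sinFun.mul hasDeriv_cosFun).add
      (hasDeriv_res continuous_id continuous_const fun t => hasDerivAt_id t)).smul
      _).congr_deriv fun t ht => ?_
    simp only [ext_add, ext_neg, ext_smul, ext_mul, ext_res _ ht]
    linear_combination (-1 / 2) * sinFun_sq_add_cosFun_sq ht
  rw [← h.integral_eq pi_mem]
  simp only [ext_add, ext_smul, ext_mul, ext_sinFun pi_mem, ext_sinFun zero_mem,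
    ext_res _ pi_mem, ext_res _ zero_mem, Real.sin_pi, Real.sin_zero, id]
  ring

lemma solvable_periodCoeff (f g h : HalfPeriodFun) :
    evalPi (prim (sinFun * h - cosFun * (f + periodCoeff f g h • cosFun +
      (g + periodCoeff f g h • cosFun)))) = 0 := by
  have h1 : sinFun * h - cosFun * (f + periodCoeff f g h • cosFun +
      (g + periodCoeff f g h • cosFun)) = (sinFun * h - cosFun * (f + g)) -
      (2 * periodCoeff f g h) • (cosFun * cosFun) := by
    ext t
    simp only [ContinuousMap.sub_apply, ContinuousMap.add_apply, ContinuousMap.mul_apply,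
      ContinuousMap.smul_apply, smul_eq_mul]
    ring
  rw [h1, map_sub, map_sub, map_smul, map_smul, evalPi_prim_cos_sq, smul_eq_mul, periodCoeff]
  field_simp
  ring

/-- The period correction at second order. -/
lemma periodCoeff_leading :
    periodCoeff (remF 0 0 secondU secondS secondD) (remG 0 0 secondU secondS)
      (remH 0 secondU secondD) = 18 / 5 + 19 * √2 / 10 := by
  have h2 : √2 * √2 = 2 := Real.mul_self_sqrt (by norm_num)
  obtain ⟨p, hp⟩ : ∃ p, p = -(2 / 5 + 6 * √2 / 5) := ⟨_, rfl⟩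
  obtain ⟨q, hq⟩ : ∃ q, q = -(11 / 10 + 4 * √2 / 5) := ⟨_, rfl⟩
  obtain ⟨A, hA⟩ : ∃ A, A = 3 / 20 + √2 / 5 := ⟨_, rfl⟩
  obtain ⟨B, hB⟩ : ∃ B, B = 7 / 20 + 3 * √2 / 10 := ⟨_, rfl⟩
  obtain ⟨β, hβ⟩ : ∃ β, β = p + (p - 1 / 2 - 2 * A) -
    ((4 * √2 + 1) * q - p + 1 / 2 + (2 + 2 * √2) * p) := ⟨_, rfl⟩
  obtain ⟨γ, hγ⟩ : ∃ γ, γ = -(p - 1 / 2 - 2 * A) -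
    ((4 * √2 + 1) * (2 * B) + p + 2 * √2 - 1 / 2 + (2 + 2 * √2) * (2 * A)) := ⟨_, rfl⟩
  have h : HasDeriv ((-p + β / 2 + 3 * γ / 8) • res id continuous_id +
      (β / 2 + 3 * γ / 8) • (sinFun * cosFun) +
      (γ / 4) • (sinFun * cosFun * (cosFun * cosFun)))
      (sinFun * remH 0 secondU secondD -
        cosFun * (remF 0 0 secondU secondS secondD + remG 0 0 secondU secondS)) := by
    refine ((((hasDeriv_res continuous_id continuous_const fun t => hasDerivAt_id t).smul _).add
      ((hasDeriv_sinFun.mul hasDeriv_cosFun).smul _)).add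
      (((hasDeriv_sinFun.mul hasDeriv_cosFun).mul
        (hasDeriv_cosFun.mul hasDeriv_cosFun)).smul _)).congr_deriv fun t ht => ?_
    have hs : sinFun.ext t ^ 2 = 1 - cosFun.ext t ^ 2 := by
      linarith [sinFun_sq_add_cosFun_sq ht]
    simp only [remF, remG, remH, secondU, secondS, secondD, ext_add, ext_sub, ext_neg, ext_smul,
      ext_mul, ext_one, ext_res _ ht]
    rw [← hp, ← hA, ← hB]
    have hpA : -(1 / 4 + √2) = p + A := by rw [hp, hA]; ring
    have hqB : -(√2 / 2 + 3 / 4) = q + B := by rw [hq, hB]; ring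
    rw [hpA, hqB]
    generalize sinFun.ext t = s at *
    generalize cosFun.ext t = c at *
    ring_nf
    have hs4 : s ^ 4 = (1 - c ^ 2) ^ 2 := by rw [← hs]; ring
    simp only [hs, hs4]
    rw [hγ, hβ]
    ring
  rw [periodCoeff, evalPi_apply, ext_prim _ pi_mem, ← h.integral_eq pi_mem]
  simp only [ext_add, ext_smul, ext_mul, ext_sinFun pi_mem, ext_sinFun zero_mem,
    ext_res _ pi_mem, ext_res _ zero_mem, Real.sin_pi, Real.sin_zero, id]
  have hpi := Real.pi_ne_zero
  have hm : -p + β / 2 + 3 * γ / 8 = 18 / 5 + 19 * √2 / 10 := by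
    rw [hγ, hβ, hA, hB, hp, hq]
    ring_nf
    rw [Real.sq_sqrt (by norm_num)]
    ring
  rw [hm]
  field_simp
  ring

end HalfPeriodFun

end Branch

section ExistsBranch

namespace HalfPeriodFun

variable {X : Type*} [NormedAddCommGroup X] [NormedSpace ℝ X]
  {ε m : X → ℝ} {U S D f g h : X → HalfPeriodFun}

lemma contDiff_remF (hε : ContDiff ℝ 1 ε) (hm : ContDiff ℝ 1 m) (hU : ContDiff ℝ 1 U)
    (hS : ContDiff ℝ 1 S) (hD : ContDiff ℝ 1 D) :
    ContDiff ℝ 1 fun x => remF (ε x) (m x) (U x) (S x) (D x) := by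
  unfold remF
  fun_prop

lemma contDiff_remG (hε : ContDiff ℝ 1 ε) (hm : ContDiff ℝ 1 m) (hU : ContDiff ℝ 1 U)
    (hS : ContDiff ℝ 1 S) : ContDiff ℝ 1 fun x => remG (ε x) (m x) (U x) (S x) := by
  unfold remG
  fun_prop

lemma contDiff_remH (hε : ContDiff ℝ 1 ε) (hU : ContDiff ℝ 1 U) (hD : ContDiff ℝ 1 D) :
    ContDiff ℝ 1 fun x => remH (ε x) (U x) (D x) := by
  unfold remH
  fun_prop

lemma contDiff_periodCoeff (hf : ContDiff ℝ 1 f) (hg : ContDiff ℝ 1 g) (hh : ContDiff ℝ 1 h) :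
    ContDiff ℝ 1 fun x => periodCoeff (f x) (g x) (h x) :=
  contDiff_const.mul (contDiff_evalPi (contDiff_prim
    ((contDiff_const.mul hh).sub (contDiff_const.mul (hf.add hg)))))

/-- Solution of the boundary value problem together with the period correction that makes it
solvable. -/
noncomputable def solveRem (f g h : HalfPeriodFun) :
    (HalfPeriodFun × HalfPeriodFun × HalfPeriodFun × HalfPeriodFun) × ℝ :=
  (linSol (f + periodCoeff f g h • cosFun) (g + periodCoeff f g h • cosFun) h, periodCoeff f g h)

lemma contDiff_solveRem (hf : ContDiff ℝ 1 f) (hg : ContDiff ℝ 1 g) (hh : ContDiff ℝ 1 h) :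
    ContDiff ℝ 1 fun x => solveRem (f x) (g x) (h x) := by
  have hm := (contDiff_periodCoeff hf hg hh).smul (contDiff_const (c := cosFun))
  exact (contDiff_linSol (hf.add hm) (hg.add hm) hh).prodMk (contDiff_periodCoeff hf hg hh)

/-- The map whose fixed points are the remainders of the branch at amplitude `ε`. -/
noncomputable def remMap
    (p : ℝ × (HalfPeriodFun × HalfPeriodFun × HalfPeriodFun × HalfPeriodFun) × ℝ) :
    (HalfPeriodFun × HalfPeriodFun × HalfPeriodFun × HalfPeriodFun) × ℝ :=
  solveRem
    (remF p.1 p.2.2 (secondU + p.1 • p.2.1.1) (secondS + p.1 • p.2.1.2.2.1)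
      (secondD + p.1 • p.2.1.2.2.2))
    (remG p.1 p.2.2 (secondU + p.1 • p.2.1.1) (secondS + p.1 • p.2.1.2.2.1))
    (remH p.1 (secondU + p.1 • p.2.1.1) (secondD + p.1 • p.2.1.2.2.2))

lemma contDiff_remMap : ContDiff ℝ 1 remMap := by
  apply contDiff_solveRem
  · apply contDiff_remF <;> fun_prop
  · apply contDiff_remG <;> fun_prop
  · apply contDiff_remH <;> fun_prop

lemma remMap_zero (e : (HalfPeriodFun × HalfPeriodFun × HalfPeriodFun × HalfPeriodFun) × ℝ) :
    remMap (0, e) = solveRem (remF 0 0 secondU secondS secondD) (remG 0 0 secondU secondS)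
      (remH 0 secondU secondD) := by
  simp [remMap, remF, remG]

/-- `x, y, z, w` solve, on the half period, the rescaled system with frequency parameter `μ`, with
Neumann boundary conditions. -/
structure IsHalfSolution (μ : ℝ) (x y z w : HalfPeriodFun) : Prop where
  hasDeriv_x : HasDeriv x y
  hasDeriv_y : HasDeriv y
    (-((μ • (z + √2 • (z * z)) + (1 / 2 : ℝ) • (w * w)) * (1 + x)))
  hasDeriv_z : HasDeriv z ((1 + x + (1 / 2 : ℝ) • (x * x)) * w)
  hasDeriv_w : HasDeriv w
    (-(μ • ((x + (1 / 2 : ℝ) • (x * x)) * (1 + (2 * √2) • z))))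
  y_zero : y.ext 0 = 0
  w_zero : w.ext 0 = 0
  y_pi : y.ext Real.pi = 0
  w_pi : w.ext Real.pi = 0

lemma isHalfSolution_of_fixedPoint {ε m : ℝ} {r₁ r₂ r₃ r₄ : HalfPeriodFun}
    (h : ((r₁, r₂, r₃, r₄), m) = remMap (ε, (r₁, r₂, r₃, r₄), m)) :
    IsHalfSolution (1 + ε ^ 2 * m)
      (ε • cosFun + ε ^ 2 • (secondU + ε • r₁))
      (-(ε • sinFun) + ε ^ 2 • (secondV + ε • r₂))
      (ε • cosFun + ε ^ 2 • (secondS + ε • r₃))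
      (-(ε • sinFun) + ε ^ 2 • (secondD + ε • r₄)) := by
  obtain ⟨F, hF⟩ : ∃ F, F = remF ε m (secondU + ε • r₁) (secondS + ε • r₃) (secondD + ε • r₄) :=
    ⟨_, rfl⟩
  obtain ⟨G, hG⟩ : ∃ G, G = remG ε m (secondU + ε • r₁) (secondS + ε • r₃) := ⟨_, rfl⟩
  obtain ⟨H, hH⟩ : ∃ H, H = remH ε (secondU + ε • r₁) (secondD + ε • r₄) := ⟨_, rfl⟩
  simp only [remMap, ← hF, ← hG, ← hH, solveRem, Prod.mk.injEq] at h
  obtain ⟨hr, hm⟩ := h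
  rw [← hm] at hr
  have hsolv := solvable_periodCoeff F G H
  rw [← hm] at hsolv
  obtain ⟨d1, d2, d3, d4⟩ := linSol_spec (F + m • cosFun) (G + m • cosFun) H
  obtain ⟨z2, z4⟩ := linSol_zero (F + m • cosFun) (G + m • cosFun) H
  obtain ⟨p2, p4⟩ := linSol_pi hsolv
  rw [← hr] at d1 d2 d3 d4 z2 z4 p2 p4
  dsimp only at d1 d2 d3 d4 z2 z4 p2 p4
  constructor
  · refine ((hasDeriv_cosFun.smul ε).add
      ((hasDeriv_secondU.add (d1.smul ε)).smul (ε ^ 2))).congr_deriv fun t _ => ?_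
    simp only [ext_add, ext_neg, ext_smul]
    ring
  · refine ((hasDeriv_sinFun.smul ε).neg.add
      ((hasDeriv_secondV.add (d2.smul ε)).smul (ε ^ 2))).congr_deriv fun t _ => ?_
    rw [hF]
    simp only [remF, ext_add, ext_sub, ext_neg, ext_smul, ext_mul, ext_one]
    ring
  · refine ((hasDeriv_cosFun.smul ε).add
      ((hasDeriv_secondS.add (d3.smul ε)).smul (ε ^ 2))).congr_deriv fun t _ => ?_
    rw [hH]
    simp only [remH, ext_add, ext_sub, ext_neg, ext_smul, ext_mul, ext_one]
    ring
  · refine ((hasDeriv_sinFun.smul ε).neg.add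
      ((hasDeriv_secondD.add (d4.smul ε)).smul (ε ^ 2))).congr_deriv fun t _ => ?_
    rw [hG]
    simp only [remG, ext_add, ext_sub, ext_neg, ext_smul, ext_mul, ext_one]
    ring
  · simp only [ext_add, ext_neg, ext_smul, secondV, ext_mul, ext_sinFun zero_mem, z2, Real.sin_zero]
    ring
  · simp only [ext_add, ext_neg, ext_smul, secondD, ext_mul, ext_sinFun zero_mem, z4, Real.sin_zero]
    ring
  · simp only [ext_add, ext_neg, ext_smul, secondV, ext_mul, ext_sinFun pi_mem, p2, Real.sin_pi]
    ring
  · simp only [ext_add, ext_neg, ext_smul, secondD, ext_mul, ext_sinFun pi_mem, p4, Real.sin_pi]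
    ring

/-- A branch of nontrivial solutions of the rescaled Neumann problem bifurcating from zero, along
which the frequency parameter grows quadratically. -/
lemma exists_branch : ∃ δ > 0, ∃ μ : ℝ → ℝ, ∃ x y z w : ℝ → HalfPeriodFun,
    ContinuousOn μ (Set.Icc 0 δ) ∧ μ 0 = 1 ∧
    ContinuousOn (fun ε => (x ε, y ε, z ε, w ε)) (Set.Icc 0 δ) ∧
    (x 0, y 0, z 0, w 0) = 0 ∧
    (∀ ε ∈ Set.Icc 0 δ, 1 + ε ^ 2 ≤ μ ε) ∧
    (∀ ε ∈ Set.Icc 0 δ, IsHalfSolution (μ ε) (x ε) (y ε) (z ε) (w ε)) ∧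
    ∀ ε ∈ Set.Ioc 0 δ, (x ε).ext Real.pi ≠ (x ε).ext 0 := by
  obtain ⟨δ, hδ, φ, hφ, hφ0, hfix⟩ :=
    exists_continuousOn_fixedPoint remMap contDiff_remMap _ remMap_zero
  have hm0 : 1 < (φ 0).2 := by
    rw [hφ0]
    change 1 < periodCoeff _ _ _
    rw [periodCoeff_leading]
    have := Real.sqrt_nonneg 2
    linarith
  have h0 : (0 : ℝ) ∈ Set.Icc 0 δ := ⟨le_rfl, hδ.le⟩
  have hnear : ∀ᶠ ε in 𝓝[Set.Icc 0 δ] (0 : ℝ), 1 < (φ ε).2 ∧ ε ^ 2 * ‖(φ ε).1.1‖ < 1 := by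
    have c1 : Tendsto (fun ε => (φ ε).2) (𝓝[Set.Icc 0 δ] 0) (𝓝 (φ 0).2) :=
      (continuous_snd.comp_continuousOn hφ) 0 h0
    have c2 : Tendsto (fun ε => ε ^ 2 * ‖(φ ε).1.1‖) (𝓝[Set.Icc 0 δ] 0)
        (𝓝 ((0 : ℝ) ^ 2 * ‖(φ 0).1.1‖)) := by
      have : ContinuousOn (fun ε => ε ^ 2 * ‖(φ ε).1.1‖) (Set.Icc 0 δ) := by fun_prop
      exact this 0 h0
    refine (c1.eventually_const_lt hm0).and (c2.eventually_lt_const ?_)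
    norm_num
  obtain ⟨r, hr, hball⟩ := Metric.eventually_nhds_iff.1 (eventually_nhdsWithin_iff.1 hnear)
  have hsub : Set.Icc 0 (min δ (r / 2)) ⊆ Set.Icc 0 δ := Set.Icc_subset_Icc_right (min_le_left _ _)
  have hgood : ∀ ε ∈ Set.Icc 0 (min δ (r / 2)), 1 < (φ ε).2 ∧ ε ^ 2 * ‖(φ ε).1.1‖ < 1 := by
    intro ε hε
    refine hball ?_ (hsub hε)
    rw [Real.dist_eq, sub_zero, abs_of_nonneg hε.1]
    linarith [hε.2.trans (min_le_right _ _)]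
  refine ⟨min δ (r / 2), by positivity, fun ε => 1 + ε ^ 2 * (φ ε).2,
    fun ε => ε • cosFun + ε ^ 2 • (secondU + ε • (φ ε).1.1),
    fun ε => -(ε • sinFun) + ε ^ 2 • (secondV + ε • (φ ε).1.2.1),
    fun ε => ε • cosFun + ε ^ 2 • (secondS + ε • (φ ε).1.2.2.1),
    fun ε => -(ε • sinFun) + ε ^ 2 • (secondD + ε • (φ ε).1.2.2.2), ?_, by simp, ?_, by simp,
    fun ε hε => ?_, fun ε hε => ?_, fun ε hε heq => ?_⟩
  · replace hφ := hφ.mono hsub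
    fun_prop
  · replace hφ := hφ.mono hsub
    fun_prop
  · have := (hgood ε hε).1
    nlinarith [sq_nonneg ε]
  · exact isHalfSolution_of_fixedPoint (hfix ε (hsub hε))
  · have hlt := (hgood ε ⟨hε.1.le, hε.2⟩).2
    have hb0 := abs_le.1 ((φ ε).1.1.abs_ext_le 0)
    have hbp := abs_le.1 ((φ ε).1.1.abs_ext_le Real.pi)
    simp only [ext_add, ext_smul, secondU, ext_sub, ext_mul, ext_one, ext_cosFun zero_mem,
      ext_cosFun pi_mem, ext_sinFun zero_mem, ext_sinFun pi_mem, Real.sin_zero, Real.sin_pi,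
      Real.cos_zero, Real.cos_pi] at heq
    have hε0 : ε ≠ 0 := hε.1.ne'
    have heq' : ε ^ 2 * ((φ ε).1.1.ext Real.pi - (φ ε).1.1.ext 0) = 2 := by
      apply mul_left_cancel₀ hε0
      linear_combination heq
    nlinarith [sq_nonneg ε]

end HalfPeriodFun

end ExistsBranch

section PeriodicExtension

/-- A periodic function `G` of definite parity that is a primitive of `g` on `[0, π]`, where `g` is
periodic and has the opposite parity, is a primitive of `g` on the whole line. -/
lemma hasDerivAt_of_integral_halfPeriod {G g : ℝ → ℝ} (hg : Continuous g)
    (hGp : Function.Periodic G (2 * Real.pi)) (hgp : Function.Periodic g (2 * Real.pi))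
    (σ : ℝ) (hGσ : ∀ t, G (-t) = σ * G t) (hgσ : ∀ t, g (-t) = -σ * g t)
    (hint : ∀ t ∈ Set.Icc 0 Real.pi, G t - G 0 = ∫ s in (0 : ℝ)..t, g s) (t : ℝ) :
    HasDerivAt G (g t) t := by
  have hi : ∀ a b : ℝ, IntervalIntegrable g MeasureTheory.volume a b :=
    fun a b => hg.intervalIntegrable a b
  obtain ⟨D, hD⟩ : ∃ D : ℝ → ℝ, D = fun t => G t - G 0 - ∫ s in (0 : ℝ)..t, g s := ⟨_, rfl⟩
  have hDpos : ∀ t ∈ Set.Icc 0 Real.pi, D t = 0 := fun t ht => by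
    rw [hD]
    exact sub_eq_zero.2 (hint t ht)
  have hDσ : ∀ t, D (-t) = σ * D t := fun t => by
    have h1 : ∫ s in (0 : ℝ)..(-t), g s = σ * ∫ s in (0 : ℝ)..t, g s := by
      have h2 := intervalIntegral.integral_comp_neg (a := 0) (b := t) g
      simp only [hgσ, neg_zero, intervalIntegral.integral_const_mul] at h2
      rw [intervalIntegral.integral_symm, ← h2]
      ring
    have h3 := hGσ 0
    rw [neg_zero] at h3
    simp only [hD, hGσ t, h1]
    linear_combination (-1 : ℝ) * h3
  have hDsymm : ∀ t ∈ Set.Icc (-Real.pi) Real.pi, D t = 0 := fun t ht => by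
    rcases le_total 0 t with h | h
    · exact hDpos t ⟨h, ht.2⟩
    · rw [← neg_neg t, hDσ, hDpos (-t) ⟨neg_nonneg.2 h, by linarith [ht.1]⟩, mul_zero]
  have hpi := Real.pi_pos
  have hzero : ∫ s in (-Real.pi)..Real.pi, g s = 0 := by
    have h1 : D Real.pi = 0 := hDsymm _ ⟨by linarith, le_rfl⟩
    have h2 : D (-Real.pi) = 0 := hDsymm _ ⟨le_rfl, by linarith⟩
    have h3 : G Real.pi = G (-Real.pi) := by
      rw [← hGp (-Real.pi)]
      congr 1
      ring
    have h4 := intervalIntegral.integral_add_adjacent_intervals (hi (-Real.pi) 0) (hi 0 Real.pi)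
    rw [intervalIntegral.integral_symm] at h4
    simp only [hD] at h1 h2
    linarith
  have hDp : Function.Periodic D (2 * Real.pi) := fun t => by
    have h1 : ∫ s in t..(t + 2 * Real.pi), g s = 0 := by
      rw [hgp.intervalIntegral_add_eq t (-Real.pi), ← hzero]
      congr 1
      ring
    have h2 := intervalIntegral.integral_add_adjacent_intervals (hi 0 t) (hi t (t + 2 * Real.pi))
    simp only [hD, hGp t]
    linarith
  have hD0 : ∀ t, D t = 0 := fun t => by
    obtain ⟨s, hs, hst⟩ := hDp.exists_mem_Ico (by positivity) t (-Real.pi)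
    rw [hst]
    exact hDsymm s ⟨hs.1, by linarith [hs.2]⟩
  have hG : G = fun t => G 0 + ∫ s in (0 : ℝ)..t, g s := by
    funext t
    have := hD0 t
    simp only [hD] at this
    linarith
  rw [hG]
  exact (intervalIntegral.integral_hasDerivAt_right (hi 0 t)
    (hg.stronglyMeasurableAtFilter _ _) hg.continuousAt).const_add (G 0)

namespace HalfPeriodFun

/-- The even `2π`-periodic extension. -/
noncomputable def evenExt (f : HalfPeriodFun) (t : ℝ) : ℝ := f.ext (Real.arccos (Real.cos t))

open Classical in
/-- The odd `2π`-periodic extension (of a function vanishing at the end points). -/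
noncomputable def oddExt (f : HalfPeriodFun) (t : ℝ) : ℝ :=
  if 0 ≤ Real.sin t then f.evenExt t else -f.evenExt t

lemma continuous_evenExt (f : HalfPeriodFun) : Continuous f.evenExt :=
  f.continuous_ext.comp (Real.continuous_arccos.comp Real.continuous_cos)

lemma evenExt_eq_zero {f : HalfPeriodFun} (h0 : f.ext 0 = 0) (hpi : f.ext Real.pi = 0) {t : ℝ}
    (ht : Real.sin t = 0) : f.evenExt t = 0 := by
  rcases Real.sin_eq_zero_iff_cos_eq.1 ht with h | h <;> simp [evenExt, h, h0, hpi]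

lemma continuous_oddExt {f : HalfPeriodFun} (h0 : f.ext 0 = 0) (hpi : f.ext Real.pi = 0) :
    Continuous f.oddExt := by
  classical
  refine Continuous.if_le f.continuous_evenExt f.continuous_evenExt.neg continuous_const
    Real.continuous_sin fun t ht => ?_
  rw [evenExt_eq_zero h0 hpi ht.symm, neg_zero]

lemma evenExt_periodic (f : HalfPeriodFun) : Function.Periodic f.evenExt (2 * Real.pi) :=
  fun t => by simp [evenExt]

lemma oddExt_periodic (f : HalfPeriodFun) : Function.Periodic f.oddExt (2 * Real.pi) :=
  fun t => by simp only [oddExt, f.evenExt_periodic t, Real.sin_add_two_pi]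

lemma evenExt_neg_arg (f : HalfPeriodFun) (t : ℝ) : f.evenExt (-t) = f.evenExt t := by
  simp [evenExt]

lemma oddExt_neg_arg {f : HalfPeriodFun} (h0 : f.ext 0 = 0) (hpi : f.ext Real.pi = 0) (t : ℝ) :
    f.oddExt (-t) = -f.oddExt t := by
  simp only [oddExt, evenExt_neg_arg, Real.sin_neg]
  rcases lt_trichotomy (Real.sin t) 0 with h | h | h
  · rw [if_pos (by linarith), if_neg (by linarith), neg_neg]
  · simp [evenExt_eq_zero h0 hpi h]
  · rw [if_neg (by linarith), if_pos h.le]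

lemma evenExt_eq_ext (f : HalfPeriodFun) {t : ℝ} (ht : t ∈ Set.Icc 0 Real.pi) :
    f.evenExt t = f.ext t := by
  rw [evenExt, Real.arccos_cos ht.1 ht.2]

lemma oddExt_eq_ext (f : HalfPeriodFun) {t : ℝ} (ht : t ∈ Set.Icc 0 Real.pi) :
    f.oddExt t = f.ext t := by
  rw [oddExt, if_pos (Real.sin_nonneg_of_nonneg_of_le_pi ht.1 ht.2), evenExt_eq_ext f ht]

lemma abs_evenExt_le (f : HalfPeriodFun) (t : ℝ) : |f.evenExt t| ≤ ‖f‖ := f.abs_ext_le _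

lemma abs_oddExt_le (f : HalfPeriodFun) (t : ℝ) : |f.oddExt t| ≤ ‖f‖ := by
  rw [oddExt]
  split_ifs
  · exact f.abs_evenExt_le t
  · rw [abs_neg]
    exact f.abs_evenExt_le t

lemma evenExt_sq (f : HalfPeriodFun) (t : ℝ) : f.evenExt t ^ 2 = f.oddExt t ^ 2 := by
  rw [oddExt]
  split_ifs <;> ring

lemma oddExt_mul (f g : HalfPeriodFun) (t : ℝ) :
    (f * g).oddExt t = f.evenExt t * g.oddExt t := by
  simp only [oddExt, evenExt, ext_mul]
  split_ifs <;> ring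

lemma HasDeriv.hasDerivAt_evenExt {F f : HalfPeriodFun} (h : HasDeriv F f) (h0 : f.ext 0 = 0)
    (hpi : f.ext Real.pi = 0) (t : ℝ) : HasDerivAt F.evenExt (f.oddExt t) t := by
  refine hasDerivAt_of_integral_halfPeriod (continuous_oddExt h0 hpi) F.evenExt_periodic
    f.oddExt_periodic 1 (fun s => by rw [evenExt_neg_arg, one_mul])
    (fun s => by rw [oddExt_neg_arg h0 hpi, neg_one_mul]) (fun s hs => ?_) t
  rw [evenExt_eq_ext F hs, evenExt_eq_ext F zero_mem, h.integral_eq hs]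
  refine intervalIntegral.integral_congr fun r hr => ?_
  rw [Set.uIcc_of_le hs.1] at hr
  exact (oddExt_eq_ext f ⟨hr.1, hr.2.trans hs.2⟩).symm

lemma HasDeriv.hasDerivAt_oddExt {F f : HalfPeriodFun} (h : HasDeriv F f) (h0 : F.ext 0 = 0)
    (hpi : F.ext Real.pi = 0) (t : ℝ) : HasDerivAt F.oddExt (f.evenExt t) t := by
  refine hasDerivAt_of_integral_halfPeriod f.continuous_evenExt F.oddExt_periodic
    f.evenExt_periodic (-1) (fun s => by rw [oddExt_neg_arg h0 hpi, neg_one_mul])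
    (fun s => by rw [evenExt_neg_arg, neg_neg, one_mul]) (fun s hs => ?_) t
  rw [oddExt_eq_ext F hs, oddExt_eq_ext F zero_mem, h.integral_eq hs]
  refine intervalIntegral.integral_congr fun r hr => ?_
  rw [Set.uIcc_of_le hs.1] at hr
  exact (evenExt_eq_ext f ⟨hr.1, hr.2.trans hs.2⟩).symm

/-- A solution of the rescaled Neumann problem gives a solution of (ham). -/
lemma IsHalfSolution.isHamSolution {μ ν : ℝ} {x y z w : HalfPeriodFun}
    (h : IsHalfSolution μ x y z w) (hν : ν ^ 2 * μ = √2) :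
    IsHamSolution (fun t => 1 + x.evenExt (ν * t)) (fun t => ν * y.oddExt (ν * t))
      (fun t => 1 / (2 * √2) + z.evenExt (ν * t) - ν / 2 * w.oddExt (ν * t))
      (fun t => 1 / (2 * √2) + z.evenExt (ν * t) + ν / 2 * w.oddExt (ν * t)) := by
  have h2 : √2 ^ 2 = 2 := Real.sq_sqrt (by norm_num)
  have hα : 1 / (2 * √2) = √2 / 4 := by
    field_simp
    linear_combination (-2 : ℝ) * h2
  have hscale : ∀ t : ℝ, HasDerivAt (fun t => ν * t) ν t := fun t => by
    simpa using (hasDerivAt_id t).const_mul ν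
  have hx : ∀ t, HasDerivAt (fun t => x.evenExt (ν * t)) (y.oddExt (ν * t) * ν) t := fun t =>
    (h.hasDeriv_x.hasDerivAt_evenExt h.y_zero h.y_pi (ν * t)).comp t (hscale t)
  have hy : ∀ t, HasDerivAt (fun t => y.oddExt (ν * t)) (_ * ν) t := fun t =>
    (h.hasDeriv_y.hasDerivAt_oddExt h.y_zero h.y_pi (ν * t)).comp t (hscale t)
  have hz : ∀ t, HasDerivAt (fun t => z.evenExt (ν * t)) (_ * ν) t := fun t =>
    (h.hasDeriv_z.hasDerivAt_evenExt (by rw [ext_mul, h.w_zero, mul_zero])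
      (by rw [ext_mul, h.w_pi, mul_zero]) (ν * t)).comp t (hscale t)
  have hw : ∀ t, HasDerivAt (fun t => w.oddExt (ν * t)) (_ * ν) t := fun t =>
    (h.hasDeriv_w.hasDerivAt_oddExt h.w_zero h.w_pi (ν * t)).comp t (hscale t)
  rw [hα]
  refine ⟨fun t => ?_, fun t => ?_, fun t => ?_, fun t => ?_⟩
  · refine ((hx t).const_add 1).congr_deriv ?_
    ring
  · refine ((hy t).const_mul ν).congr_deriv ?_
    have hsq := w.evenExt_sq (ν * t)
    simp only [evenExt, ext_mul, ext_neg, ext_add, ext_smul, ext_one] at hsq ⊢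
    generalize x.ext _ = X at *
    generalize z.ext _ = Z at *
    generalize w.ext _ = W at *
    generalize w.oddExt _ = W' at *
    linear_combination (-(Z + √2 * Z ^ 2) * (1 + X)) * hν + (-(1 / 2) * ν ^ 2 * (1 + X)) * hsq +
      (1 / 8 - Z ^ 2) * (1 + X) * h2
  · refine (((hz t).const_add _).sub ((hw t).const_mul (ν / 2))).congr_deriv ?_
    rw [oddExt_mul]
    simp only [evenExt, ext_mul, ext_neg, ext_add, ext_smul, ext_one]
    generalize x.ext _ = X at *
    generalize z.ext _ = Z at *
    generalize w.oddExt _ = W' at *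
    linear_combination (1 / 2 * (X + 1 / 2 * X ^ 2) * (1 + 2 * √2 * Z)) * hν +
      (X + 1 / 2 * X ^ 2) * Z * h2
  · refine (((hz t).const_add _).add ((hw t).const_mul (ν / 2))).congr_deriv ?_
    rw [oddExt_mul]
    simp only [evenExt, ext_mul, ext_neg, ext_add, ext_smul, ext_one]
    generalize x.ext _ = X at *
    generalize z.ext _ = Z at *
    generalize w.oddExt _ = W' at *
    linear_combination (-1 / 2 * (X + 1 / 2 * X ^ 2) * (1 + 2 * √2 * Z)) * hν -
      (X + 1 / 2 * X ^ 2) * Z * h2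

end HalfPeriodFun

end PeriodicExtension

section Convergence

/-- If the states converge to `p` uniformly on the line, then continuous functions of the state
converge uniformly on every set. -/
lemma tendstoUniformlyOn_of_state {E : Type*} [TopologicalSpace E] {l : Filter ℝ}
    {W : ℝ → ℝ → E} {p : E} (hW : Tendsto (fun q : ℝ × ℝ => W q.1 q.2) (l ×ˢ ⊤) (𝓝 p))
    {F : ℝ → ℝ → ℝ} {c : ℝ → ℝ} (Φ : E → ℝ) (hΦ : Continuous Φ) (hc : ∀ t, c t = Φ p)
    (hF : ∀ᶠ T in l, ∀ t, F T t = Φ (W T t)) (K : Set ℝ) : TendstoUniformlyOn F c l K := by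
  have h := (hΦ.tendsto p).comp hW
  rw [Metric.tendstoUniformlyOn_iff]
  intro η hη
  have h1 := h.eventually (Metric.ball_mem_nhds _ hη)
  rw [← principal_univ, eventually_prod_principal_iff] at h1
  filter_upwards [h1, hF] with T hT hFT t _
  rw [hc, hFT, dist_comm]
  exact hT t (Set.mem_univ t)

namespace IsHamSolution

variable {u v a b : ℝ → ℝ}

lemma deriv_u (h : IsHamSolution u v a b) : deriv u = v := funext fun t => (h.1 t).deriv

lemma deriv_v (h : IsHamSolution u v a b) :
    deriv v = fun t => -((a t) ^ 2 + (b t) ^ 2 - 1 / 4) * u t := funext fun t => (h.2.1 t).deriv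

lemma deriv_a (h : IsHamSolution u v a b) : deriv a = fun t => -(a t) + (u t) ^ 2 * b t :=
  funext fun t => (h.2.2.1 t).deriv

lemma deriv_b (h : IsHamSolution u v a b) : deriv b = fun t => b t - (u t) ^ 2 * a t :=
  funext fun t => (h.2.2.2 t).deriv

lemma deriv_deriv_v (h : IsHamSolution u v a b) : deriv (deriv v) = fun t =>
    -(2 * a t * (-(a t) + (u t) ^ 2 * b t) + 2 * b t * (b t - (u t) ^ 2 * a t)) * u t +
      -((a t) ^ 2 + (b t) ^ 2 - 1 / 4) * v t := by
  rw [h.deriv_v]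
  funext t
  have h1 := ((((h.2.2.1 t).pow 2).add ((h.2.2.2 t).pow 2)).sub_const (1 / 4)).neg.mul (h.1 t)
  refine (h1.congr_deriv ?_).deriv
  simp

end IsHamSolution

/-- Uniform convergence of a family of solutions of (ham) to `P₊` upgrades to derivatives. -/
lemma IsHamSolution.tendstoUniformlyOn_iteratedDeriv {l : Filter ℝ} {u v a b : ℝ → ℝ → ℝ}
    (hsol : ∀ᶠ T in l, IsHamSolution (u T) (v T) (a T) (b T))
    (hlim : Tendsto (fun q : ℝ × ℝ => (u q.1 q.2, v q.1 q.2, a q.1 q.2, b q.1 q.2)) (l ×ˢ ⊤)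
      (𝓝 (1, 0, 1 / (2 * √2), 1 / (2 * √2)))) (K : Set ℝ) :
    (∀ k : ℕ, k ≤ 2 →
      TendstoUniformlyOn (fun T t => iteratedDeriv k (u T) t) (iteratedDeriv k fun _ => (1 : ℝ))
        l K ∧
      TendstoUniformlyOn (fun T t => iteratedDeriv k (v T) t) (iteratedDeriv k fun _ => (0 : ℝ))
        l K) ∧
    (∀ k : ℕ, k ≤ 1 →
      TendstoUniformlyOn (fun T t => iteratedDeriv k (a T) t)
        (iteratedDeriv k fun _ => 1 / (2 * √2)) l K ∧
      TendstoUniformlyOn (fun T t => iteratedDeriv k (b T) t)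
        (iteratedDeriv k fun _ => 1 / (2 * √2)) l K) := by
  have hα : (1 / (2 * √2)) ^ 2 + (1 / (2 * √2)) ^ 2 - 1 / 4 = 0 := by
    rw [div_pow, mul_pow, Real.sq_sqrt (by norm_num)]
    norm_num
  have key := fun (F : ℝ → ℝ → ℝ) (c : ℝ → ℝ) (Φ : ℝ × ℝ × ℝ × ℝ → ℝ) =>
    tendstoUniformlyOn_of_state (W := fun T t => (u T t, v T t, a T t, b T t)) (F := F) (c := c)
      hlim Φ
  constructor
  · intro k hk
    interval_cases k
    · exact ⟨key _ _ (fun s => s.1) (by fun_prop) (by simp) (by simp) K,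
        key _ _ (fun s => s.2.1) (by fun_prop) (by simp) (by simp) K⟩
    · refine ⟨key _ _ (fun s => s.2.1) (by fun_prop) (by simp [iteratedDeriv_const]) ?_ K,
        key _ _ (fun s => -(s.2.2.1 ^ 2 + s.2.2.2 ^ 2 - 1 / 4) * s.1) (by fun_prop)
          (fun t => by simp only [hα, neg_zero, zero_mul]; simp) ?_ K⟩
      · filter_upwards [hsol] with T hT t
        rw [iteratedDeriv_one, hT.deriv_u]
      · filter_upwards [hsol] with T hT t
        rw [iteratedDeriv_one, hT.deriv_v]
    · refine ⟨key _ _ (fun s => -(s.2.2.1 ^ 2 + s.2.2.2 ^ 2 - 1 / 4) * s.1) (by fun_prop)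
          (fun t => by simp only [hα, neg_zero, zero_mul]; simp [iteratedDeriv_const]) ?_ K,
        key _ _ (fun s => -(2 * s.2.2.1 * (-s.2.2.1 + s.1 ^ 2 * s.2.2.2) +
          2 * s.2.2.2 * (s.2.2.2 - s.1 ^ 2 * s.2.2.1)) * s.1 +
          -(s.2.2.1 ^ 2 + s.2.2.2 ^ 2 - 1 / 4) * s.2.1) (by fun_prop)
          (by simp) ?_ K⟩
      · filter_upwards [hsol] with T hT t
        rw [iteratedDeriv_succ, iteratedDeriv_one, hT.deriv_u, hT.deriv_v]
      · filter_upwards [hsol] with T hT t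
        rw [iteratedDeriv_succ, iteratedDeriv_one, hT.deriv_deriv_v]
  · intro k hk
    interval_cases k
    · exact ⟨key _ _ (fun s => s.2.2.1) (by fun_prop) (by simp) (by simp) K,
        key _ _ (fun s => s.2.2.2) (by fun_prop) (by simp) (by simp) K⟩
    · refine ⟨key _ _ (fun s => -s.2.2.1 + s.1 ^ 2 * s.2.2.2) (by fun_prop)
          (by simp [iteratedDeriv_const]) ?_ K,
        key _ _ (fun s => s.2.2.2 - s.1 ^ 2 * s.2.2.1) (by fun_prop)
          (by simp [iteratedDeriv_const]) ?_ K⟩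
      · filter_upwards [hsol] with T hT t
        rw [iteratedDeriv_one, hT.deriv_a]
      · filter_upwards [hsol] with T hT t
        rw [iteratedDeriv_one, hT.deriv_b]

end Convergence

/-- There exists `T₁ > T₀ := 2^(3/4)·π` such that for every
`T ∈ (T₀, T₁)` the Hamiltonian system (ham) admits a non-constant `2T`-periodic solution
`(u_T, v_T, a_T, b_T)`; as `T → T₀⁺` these solutions converge to the constant solution
`P₊ = (1, 0, 1/(2√2), 1/(2√2))`, uniformly on compact subsets of `ℝ` together with their
derivatives (up to order `2` for `u_T, v_T` and order `1` for `a_T, b_T`). -/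
theorem small_period_solutions :
    ∃ T₁ : ℝ, (2 : ℝ) ^ ((3 : ℝ) / 4) * Real.pi < T₁ ∧
    ∃ u v a b : ℝ → ℝ → ℝ,
      (∀ T ∈ Set.Ioo ((2 : ℝ) ^ ((3 : ℝ) / 4) * Real.pi) T₁,
        IsHamSolution (u T) (v T) (a T) (b T) ∧
        Function.Periodic (u T) (2 * T) ∧ Function.Periodic (v T) (2 * T) ∧
        Function.Periodic (a T) (2 * T) ∧ Function.Periodic (b T) (2 * T) ∧
        ¬ (∀ s t : ℝ,
            u T s = u T t ∧ v T s = v T t ∧ a T s = a T t ∧ b T s = b T t)) ∧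
      (∀ K : Set ℝ, IsCompact K →
        (∀ k : ℕ, k ≤ 2 →
          TendstoUniformlyOn (fun T t => iteratedDeriv k (u T) t)
            (iteratedDeriv k fun _ => (1 : ℝ))
            (𝓝[>] ((2 : ℝ) ^ ((3 : ℝ) / 4) * Real.pi)) K ∧
          TendstoUniformlyOn (fun T t => iteratedDeriv k (v T) t)
            (iteratedDeriv k fun _ => (0 : ℝ))
            (𝓝[>] ((2 : ℝ) ^ ((3 : ℝ) / 4) * Real.pi)) K) ∧
        (∀ k : ℕ, k ≤ 1 →
          TendstoUniformlyOn (fun T t => iteratedDeriv k (a T) t)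
            (iteratedDeriv k fun _ => 1 / (2 * Real.sqrt 2))
            (𝓝[>] ((2 : ℝ) ^ ((3 : ℝ) / 4) * Real.pi)) K ∧
          TendstoUniformlyOn (fun T t => iteratedDeriv k (b T) t)
            (iteratedDeriv k fun _ => 1 / (2 * Real.sqrt 2))
            (𝓝[>] ((2 : ℝ) ^ ((3 : ℝ) / 4) * Real.pi)) K)) := by
  obtain ⟨T₀, hT₀⟩ : ∃ T₀, T₀ = (2 : ℝ) ^ ((3 : ℝ) / 4) * Real.pi := ⟨_, rfl⟩
  rw [← hT₀]
  have hpi := Real.pi_pos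
  have hT₀pos : 0 < T₀ := by
    rw [hT₀]
    positivity
  have hT₀sq : T₀ ^ 2 = 2 * √2 * Real.pi ^ 2 := by
    have h1 : ((2 : ℝ) ^ ((3 : ℝ) / 4)) ^ 2 = 2 * √2 := by
      rw [← Real.rpow_natCast, ← Real.rpow_mul (by norm_num), Real.sqrt_eq_rpow,
        ← Real.rpow_one_add' (by norm_num) (by norm_num)]
      norm_num
    rw [hT₀, mul_pow, h1]
  obtain ⟨δ, hδ, μ, x, y, z, w, hμc, hμ0, hsc, hs0, hμ, hsol, hne⟩ :=
    HalfPeriodFun.exists_branch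
  have hδmem : δ ∈ Set.Icc 0 δ := ⟨hδ.le, le_rfl⟩
  have hμδ : 1 < μ δ := lt_of_lt_of_le (by nlinarith) (hμ δ hδmem)
  have hivt : ∀ T ∈ Set.Ioo T₀ (T₀ * √(μ δ)), ∃ ε ∈ Set.Ioo 0 δ, T₀ * √(μ ε) = T := by
    have h1 : ContinuousOn (fun ε => T₀ * √(μ ε)) (Set.Icc 0 δ) :=
      continuousOn_const.mul hμc.sqrt
    have h2 := intermediate_value_Ioo hδ.le h1
    simp only [hμ0, Real.sqrt_one, mul_one] at h2
    exact fun T hT => h2 hT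
  choose! e he heT using hivt
  have heIcc : ∀ T ∈ Set.Ioo T₀ (T₀ * √(μ δ)), e T ∈ Set.Icc 0 δ := fun T hT =>
    Set.Ioo_subset_Icc_self (he T hT)
  have hT₁ : T₀ < T₀ * √(μ δ) := by
    have : 1 < √(μ δ) := by
      rw [Real.lt_sqrt (by norm_num)]
      simpa using hμδ
    nlinarith
  have hsq : ∀ T ∈ Set.Ioo T₀ (T₀ * √(μ δ)), T ^ 2 = T₀ ^ 2 * μ (e T) := fun T hT => by
    have h1 : 0 ≤ μ (e T) := by nlinarith [hμ (e T) (heIcc T hT), sq_nonneg (e T)]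
    rw [← Real.sq_sqrt h1, ← mul_pow, heT T hT]
  have hν : ∀ T ∈ Set.Ioo T₀ (T₀ * √(μ δ)), (2 * Real.pi / T) ^ 2 * μ (e T) = √2 := by
    intro T hT
    have hTpos : 0 < T := hT₀pos.trans hT.1
    have h2 : √2 ^ 2 = 2 := Real.sq_sqrt (by norm_num)
    have h3 := hsq T hT
    rw [hT₀sq] at h3
    rw [div_pow, div_mul_eq_mul_div, div_eq_iff (by positivity), h3]
    linear_combination (-2 * Real.pi ^ 2 * μ (e T)) * h2
  have hev : ∀ᶠ T in 𝓝[>] T₀, T ∈ Set.Ioo T₀ (T₀ * √(μ δ)) := Ioo_mem_nhdsGT hT₁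
  have hsolT := fun T (hT : T ∈ Set.Ioo T₀ (T₀ * √(μ δ))) =>
    (hsol (e T) (heIcc T hT)).isHamSolution (hν T hT)
  refine ⟨T₀ * √(μ δ), hT₁, _, _, _, _, fun T hT => ⟨hsolT T hT, ?_⟩, fun K _ =>
    IsHamSolution.tendstoUniformlyOn_iteratedDeriv (hev.mono hsolT) ?_ K⟩
  · have hTpos : 0 < T := hT₀pos.trans hT.1
    have hper : ∀ f : ℝ → ℝ, Function.Periodic f (2 * Real.pi) →
        Function.Periodic (fun t => f (2 * Real.pi / T * t)) (2 * T) := by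
      intro f hf t
      have h1 : 2 * Real.pi / T * (t + 2 * T) =
          2 * Real.pi / T * t + 2 * Real.pi + 2 * Real.pi := by
        field_simp
        ring
      simp only [h1, hf _]
    have hX := hper _ (x (e T)).evenExt_periodic
    have hY := hper _ (y (e T)).oddExt_periodic
    have hZ := hper _ (z (e T)).evenExt_periodic
    have hW := hper _ (w (e T)).oddExt_periodic
    refine ⟨fun t => ?_, fun t => ?_, fun t => ?_, fun t => ?_, fun hconst => ?_⟩
    · exact congrArg (1 + ·) (hX t)
    · exact congrArg (2 * Real.pi / T * ·) (hY t)
    · exact congrArg₂ (fun p q => 1 / (2 * √2) + p - 2 * Real.pi / T / 2 * q) (hZ t) (hW t)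
    · exact congrArg₂ (fun p q => 1 / (2 * √2) + p + 2 * Real.pi / T / 2 * q) (hZ t) (hW t)
    · have h1 := (hconst (T / 2) 0).1
      have h2 : 2 * Real.pi / T * (T / 2) = Real.pi := by
        field_simp
      simp only [h2, mul_zero, HalfPeriodFun.evenExt_eq_ext _ HalfPeriodFun.pi_mem,
        HalfPeriodFun.evenExt_eq_ext _ HalfPeriodFun.zero_mem] at h1
      exact hne (e T) ⟨(he T hT).1, (he T hT).2.le⟩ (add_left_cancel h1)
  · have he0 : Tendsto e (𝓝[>] T₀) (𝓝 0) := by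
      have h1 : Tendsto (fun T => √((T / T₀) ^ 2 - 1)) (𝓝[>] T₀) (𝓝 0) := by
        have h2 : Continuous fun T => √((T / T₀) ^ 2 - 1) := by fun_prop
        have h3 := h2.tendsto T₀
        rw [div_self hT₀pos.ne'] at h3
        simpa using h3.mono_left nhdsWithin_le_nhds
      refine squeeze_zero' (hev.mono fun T hT => (he T hT).1.le) (hev.mono fun T hT => ?_) h1
      refine Real.le_sqrt_of_sq_le ?_
      have h4 := hμ (e T) (heIcc T hT)
      rw [div_pow, hsq T hT]
      field_simp
      linarith
    have heW : Tendsto e (𝓝[>] T₀) (𝓝[Set.Icc 0 δ] 0) :=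
      tendsto_nhdsWithin_iff.2 ⟨he0, hev.mono heIcc⟩
    have hs : Tendsto (fun T => (x (e T), y (e T), z (e T), w (e T))) (𝓝[>] T₀) (𝓝 0) := by
      rw [← hs0]
      exact (hsc 0 ⟨le_rfl, hδ.le⟩).tendsto.comp heW
    have hfst : Tendsto (Prod.fst : ℝ × ℝ → ℝ) (𝓝[>] T₀ ×ˢ ⊤) (𝓝[>] T₀) := tendsto_fst
    have hnuT : Tendsto (fun q : ℝ × ℝ => 2 * Real.pi / q.1) (𝓝[>] T₀ ×ˢ ⊤)
        (𝓝 (2 * Real.pi / T₀)) :=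
      (tendsto_const_nhds.div (tendsto_nhdsWithin_of_tendsto_nhds tendsto_id)
        hT₀pos.ne').comp hfst
    have hx := (continuous_fst.tendsto _).comp hs
    have hy := ((continuous_fst.comp continuous_snd).tendsto _).comp hs
    have hz := ((continuous_fst.comp (continuous_snd.comp continuous_snd)).tendsto _).comp hs
    have hw := ((continuous_snd.comp (continuous_snd.comp continuous_snd)).tendsto _).comp hs
    have heven : ∀ f : ℝ → HalfPeriodFun, Tendsto f (𝓝[>] T₀) (𝓝 0) →
        Tendsto (fun q : ℝ × ℝ => (f q.1).evenExt (2 * Real.pi / q.1 * q.2)) (𝓝[>] T₀ ×ˢ ⊤)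
          (𝓝 0) := fun f hf =>
      squeeze_zero_norm (fun q => (f q.1).abs_evenExt_le _)
        ((tendsto_zero_iff_norm_tendsto_zero.1 hf).comp hfst)
    have hodd : ∀ f : ℝ → HalfPeriodFun, Tendsto f (𝓝[>] T₀) (𝓝 0) →
        Tendsto (fun q : ℝ × ℝ => (f q.1).oddExt (2 * Real.pi / q.1 * q.2)) (𝓝[>] T₀ ×ˢ ⊤)
          (𝓝 0) := fun f hf =>
      squeeze_zero_norm (fun q => (f q.1).abs_oddExt_le _)
        ((tendsto_zero_iff_norm_tendsto_zero.1 hf).comp hfst)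
    have hX := heven _ hx
    have hY := hnuT.mul (hodd _ hy)
    have hZ := (heven _ hz).const_add (1 / (2 * √2))
    have hW := (hnuT.div_const 2).mul (hodd _ hw)
    rw [mul_zero] at hY hW
    have hA := hZ.sub hW
    have hB := hZ.add hW
    rw [add_zero, sub_zero] at hA
    rw [add_zero, add_zero] at hB
    have hX' := hX.const_add 1
    rw [add_zero] at hX'
    exact hX'.prodMk_nhds (hY.prodMk_nhds (hA.prodMk_nhds hB))
end

section
/- Let T > 0, λ ∈ ℝ, and let z : ℝ → ℝ² be a non-identically-zero C¹ function that is 2T-periodic and satisfies Az = λ·z on ℝ. Then λ² = 1 + (kπ/T)² for some non-negative integer k; in particular |λ| ≥ 1, and the only 2T-periodic C¹ solution of Az = 0 is z ≡ 0 (A has trivial kernel). -/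
/-- The matrix `J` with rows `(0,1), (−1,0)`. -/
def matJ : Matrix (Fin 2) (Fin 2) ℝ := !![0, 1; -1, 0]

/-- The matrix `B` with rows `(−1,0), (0,1)`. -/
def matB : Matrix (Fin 2) (Fin 2) ℝ := !![-1, 0; 0, 1]

/-- The operator `A z = −J z' + J B z`. -/
noncomputable def opA (z : ℝ → Fin 2 → ℝ) : ℝ → Fin 2 → ℝ :=
  fun t => -(matJ.mulVec (deriv z t)) + matJ.mulVec (matB.mulVec (z t))

/-- A periodic solution of `g' = ω g` vanishes unless `exp (ω P) = 1`. -/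
theorem eq_zero_of_hasDerivAt_mul_of_periodic {g : ℝ → ℂ} {ω : ℂ} {P : ℝ}
    (hg : ∀ t, HasDerivAt g (ω * g t) t) (hper : Function.Periodic g P)
    (hω : Complex.exp (ω * P) ≠ 1) (t : ℝ) : g t = 0 := by
  have hd : ∀ s : ℝ, HasDerivAt (fun s : ℝ => Complex.exp (-ω * s) * g s) 0 s := by
    intro s
    have he : HasDerivAt (fun s : ℝ => Complex.exp (-ω * s))
        (Complex.exp (-ω * s) * (-ω * 1)) s :=
      ((Complex.ofRealCLM.hasDerivAt (x := s)).const_mul (-ω)).cexp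
    refine (he.mul (hg s)).congr_deriv ?_
    ring
  have hc := is_const_of_deriv_eq_zero (fun s => (hd s).differentiableAt)
    (fun s => (hd s).deriv) (t + P) t
  simp only [hper t, Complex.ofReal_add, mul_add, Complex.exp_add] at hc
  by_contra h
  have h1 : Complex.exp (-ω * P) = 1 := by
    have := mul_right_cancel₀ h hc
    exact mul_left_cancel₀ (Complex.exp_ne_zero (-ω * t)) (by rw [this, mul_one])
  apply hω
  rw [neg_mul, Complex.exp_neg, inv_eq_one] at h1
  exact h1

/-- A nonzero periodic solution of `f'' = c f` forces `c` to be an eigenvalue of the second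
derivative on a circle of length `2 * T`. -/
theorem exists_eq_neg_sq_of_periodic {f f' : ℝ → ℝ} {c T : ℝ} (hT : 0 < T)
    (hf : ∀ t, HasDerivAt f (f' t) t) (hf' : ∀ t, HasDerivAt f' (c * f t) t)
    (hper : Function.Periodic f (2 * T)) (hper' : Function.Periodic f' (2 * T))
    (hne : f ≠ 0) : ∃ k : ℕ, c = -(k * Real.pi / T) ^ 2 := by
  obtain ⟨ω, hω⟩ := IsAlgClosed.exists_pow_nat_eq (c : ℂ) (n := 2) (by norm_num)
  have hzero : ∀ ν : ℂ, ν ^ 2 = c → Complex.exp (ν * (2 * T : ℝ)) ≠ 1 →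
      ∀ t, (f' t : ℂ) + ν * f t = 0 := by
    intro ν hν hexp
    refine eq_zero_of_hasDerivAt_mul_of_periodic (fun t => ?_) (fun t => ?_) hexp
    · refine ((hf' t).ofReal_comp.add ((hf t).ofReal_comp.const_mul ν)).congr_deriv ?_
      push_cast
      rw [← hν]
      ring
    · simp only [hper t, hper' t]
  by_cases hexp : Complex.exp (ω * (2 * T : ℝ)) = 1
  · obtain ⟨n, hn⟩ := Complex.exp_eq_one_iff.mp hexp
    have hT' : (T : ℂ) ≠ 0 := by exact_mod_cast hT.ne'
    have hω' : ω = n * Real.pi / T * Complex.I := by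
      push_cast at hn
      field_simp
      linear_combination hn / 2
    refine ⟨n.natAbs, ?_⟩
    have hk : ((n.natAbs : ℕ) : ℝ) ^ 2 = (n : ℝ) ^ 2 := by
      rw [Nat.cast_natAbs, Int.cast_abs, sq_abs]
    have hc : c = -(n * Real.pi / T) ^ 2 := by
      rw [hω', mul_pow, Complex.I_sq] at hω
      exact_mod_cast (by linear_combination -hω :
        (c : ℂ) = -((n : ℂ) * (Real.pi : ℂ) / (T : ℂ)) ^ 2)
    rw [hc, div_pow, div_pow, mul_pow, mul_pow, hk]
  · exfalso
    apply hne
    have hexp' : Complex.exp (-ω * (2 * T : ℝ)) ≠ 1 := by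
      rwa [neg_mul, Complex.exp_neg, ne_eq, inv_eq_one]
    have hω0 : ω ≠ 0 := by
      rintro rfl
      simp at hexp
    funext t
    have h1 := hzero ω hω hexp t
    have h2 := hzero (-ω) (by rw [neg_sq, hω]) hexp' t
    have h3 : ω * (f t : ℂ) = 0 := by linear_combination (h1 - h2) / 2
    exact_mod_cast (mul_eq_zero.mp h3).resolve_left hω0

/-- Nonzero periodic eigenfunctions of `opA` only exist for `lam ^ 2 = 1 + (k π / T) ^ 2`. -/
theorem exists_sq_eq_of_opA_eq_smul {T lam : ℝ} (hT : 0 < T) {z : ℝ → Fin 2 → ℝ}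
    (hz : Differentiable ℝ z) (hne : z ≠ 0) (hper : Function.Periodic z (2 * T))
    (heig : ∀ t, opA z t = lam • z t) :
    ∃ k : ℕ, lam ^ 2 = 1 + (k * Real.pi / T) ^ 2 := by
  have hd : ∀ i t, HasDerivAt (fun s => z s i) (deriv z t i) t :=
    fun i t => hasDerivAt_pi.mp (hz t).hasDerivAt i
  have h0 : ∀ t, HasDerivAt (fun s => z s 0) (-z t 0 + lam * z t 1) t := by
    intro t
    have h := congrFun (heig t) 1
    simp [opA, matJ, matB, dotProduct, Fin.sum_univ_two] at h
    convert hd 0 t using 1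
    linarith
  have h1 : ∀ t, HasDerivAt (fun s => z s 1) (z t 1 - lam * z t 0) t := by
    intro t
    have h := congrFun (heig t) 0
    simp [opA, matJ, matB, dotProduct, Fin.sum_univ_two] at h
    convert hd 1 t using 1
    linarith
  have h0' : ∀ t, HasDerivAt (fun s => -z s 0 + lam * z s 1) ((1 - lam ^ 2) * z t 0) t := by
    intro t
    refine ((h0 t).neg.add ((h1 t).const_mul lam)).congr_deriv ?_
    ring
  have h1' : ∀ t, HasDerivAt (fun s => z s 1 - lam * z s 0) ((1 - lam ^ 2) * z t 1) t := by
    intro t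
    refine ((h1 t).sub ((h0 t).const_mul lam)).congr_deriv ?_
    ring
  obtain ⟨k, hk⟩ : ∃ k : ℕ, 1 - lam ^ 2 = -(k * Real.pi / T) ^ 2 := by
    by_cases hz0 : (fun s => z s 0) = 0
    · refine exists_eq_neg_sq_of_periodic hT h1 h1' (fun t => by simp only [hper t])
        (fun t => by simp only [hper t]) fun hz1 => hne ?_
      funext t i
      fin_cases i
      exacts [congrFun hz0 t, congrFun hz1 t]
    · exact exists_eq_neg_sq_of_periodic hT h0 h0' (fun t => by simp only [hper t])
        (fun t => by simp only [hper t]) hz0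
  exact ⟨k, by linarith⟩

/-- Let `T > 0`, `λ ∈ ℝ`, and let `z : ℝ → ℝ²` be a non-identically-zero
`C¹` function, `2T`-periodic, with `Az = λ·z` on `ℝ`. Then `λ² = 1 + (kπ/T)²` for some
`k ∈ ℕ`; in particular `|λ| ≥ 1`, and the only `2T`-periodic `C¹` solution of `Az = 0` is
`z ≡ 0` (so `A` has trivial kernel). -/
theorem opA_eigenvalues (T : ℝ) (hT : 0 < T) (lam : ℝ) (z : ℝ → Fin 2 → ℝ)
    (hz : ContDiff ℝ 1 z) (hne : z ≠ 0) (hper : Function.Periodic z (2 * T))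
    (heig : ∀ t, opA z t = lam • z t) :
    (∃ k : ℕ, lam ^ 2 = 1 + (k * Real.pi / T) ^ 2) ∧
    1 ≤ |lam| ∧
    (∀ w : ℝ → Fin 2 → ℝ, ContDiff ℝ 1 w → Function.Periodic w (2 * T) →
      (∀ t, opA w t = 0) → w = 0) := by
  obtain ⟨k, hk⟩ := exists_sq_eq_of_opA_eq_smul hT (hz.differentiable one_ne_zero) hne hper heig
  refine ⟨⟨k, hk⟩, ?_, fun w hw hwper hA => ?_⟩
  · rw [← one_le_sq_iff_one_le_abs, hk]
    exact le_add_of_nonneg_right (sq_nonneg _)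
  · by_contra hw0
    obtain ⟨m, hm⟩ := exists_sq_eq_of_opA_eq_smul (lam := 0) hT (hw.differentiable one_ne_zero)
      hw0 hwper (fun t => by rw [hA t, zero_smul])
    nlinarith [sq_nonneg (m * Real.pi / T)]
end

section
/- (Vanishing lemma.) Let ε_n → 0⁺, let r > 0, and let u_n : ℝ → ℝ be 2-periodic C¹ functions such that the rescaled H¹ norms are bounded: there is M > 0 with (1/ε_n)·∫_{−1}^{1} (ε_n²·|u_n'|² + u_n²/4) dt ≤ M for all n. If sup_{y ∈ [−1,1]} (1/ε_n)·∫_{|t−y| ≤ 2ε_n r} |u_n|² dt → 0 as n → ∞, then for every q ∈ (2, ∞) one has (1/ε_n)·∫_{−1}^{1} |u_n|^q dt → 0 as n → ∞. -/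
open Filter Topology

/-- Sobolev-type bound on an interval: the square of a `C¹` function at a point is controlled by
its mean square plus a weighted combination of the `L²` norms of the function and its derivative. -/
lemma sq_mul_length_le_of_contDiff {f : ℝ → ℝ} (hf : ContDiff ℝ 1 f) {c d x κ : ℝ}
    (hx : x ∈ Set.Icc c d) (hκ : 0 < κ) :
    (d - c) * f x ^ 2 ≤ (∫ t in c..d, f t ^ 2) +
      (d - c) * (κ * (∫ t in c..d, f t ^ 2) + κ⁻¹ * ∫ t in c..d, deriv f t ^ 2) := by
  have hcd : c ≤ d := hx.1.trans hx.2
  have hfc : Continuous f := hf.continuous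
  have hdc : Continuous (deriv f) := hf.continuous_deriv le_rfl
  set K : ℝ := κ * (∫ t in c..d, f t ^ 2) + κ⁻¹ * ∫ t in c..d, deriv f t ^ 2 with hK
  have hKint : K = ∫ t in c..d, (κ * f t ^ 2 + κ⁻¹ * deriv f t ^ 2) := by
    rw [intervalIntegral.integral_add, intervalIntegral.integral_const_mul,
      intervalIntegral.integral_const_mul]
    all_goals exact Continuous.intervalIntegrable (by fun_prop) _ _
  have hpt : ∀ y ∈ Set.Icc c d, f x ^ 2 - K ≤ f y ^ 2 := by
    intro y hy
    have hftc : ∫ t in y..x, 2 * f t * deriv f t = f x ^ 2 - f y ^ 2 := by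
      refine intervalIntegral.integral_eq_sub_of_hasDerivAt (f := fun t => f t ^ 2)
        (fun t _ => ?_) (Continuous.intervalIntegrable (by fun_prop) _ _)
      have h := ((hf.differentiable one_ne_zero) t).hasDerivAt.fun_pow 2
      simpa only [Nat.cast_ofNat, Nat.add_one_sub_one, pow_one] using h
    have habs : |∫ t in y..x, 2 * f t * deriv f t| ≤
        |∫ t in y..x, (κ * f t ^ 2 + κ⁻¹ * deriv f t ^ 2)| := by
      rw [← Real.norm_eq_abs (∫ t in y..x, 2 * f t * deriv f t)]
      refine intervalIntegral.norm_integral_le_abs_of_norm_le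
        (Filter.Eventually.of_forall fun t => ?_)
        (Continuous.intervalIntegrable (by fun_prop) _ _)
      have hsq : κ * f t ^ 2 + κ⁻¹ * deriv f t ^ 2 - 2 * f t * deriv f t =
          κ⁻¹ * (κ * f t - deriv f t) ^ 2 := by field_simp; ring
      have hsq' : κ * f t ^ 2 + κ⁻¹ * deriv f t ^ 2 + 2 * f t * deriv f t =
          κ⁻¹ * (κ * f t + deriv f t) ^ 2 := by field_simp; ring
      have h₁ : 0 ≤ κ⁻¹ * (κ * f t - deriv f t) ^ 2 := by positivity
      have h₂ : 0 ≤ κ⁻¹ * (κ * f t + deriv f t) ^ 2 := by positivity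
      rw [Real.norm_eq_abs, abs_le]
      constructor <;> linarith
    have hmono : |∫ t in y..x, (κ * f t ^ 2 + κ⁻¹ * deriv f t ^ 2)| ≤ K := by
      have hpos : ∀ t, 0 ≤ κ * f t ^ 2 + κ⁻¹ * deriv f t ^ 2 := fun t => by positivity
      rw [hKint, ← abs_of_nonneg (intervalIntegral.integral_nonneg hcd fun t _ => hpos t)]
      refine intervalIntegral.abs_integral_mono_interval ?_
        (Filter.Eventually.of_forall hpos) (Continuous.intervalIntegrable (by fun_prop) _ _)
      rw [Set.uIoc_of_le hcd]
      exact Set.Ioc_subset_Ioc (le_min hy.1 hx.1) (max_le hy.2 hx.2)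
    have := le_abs_self (∫ t in y..x, 2 * f t * deriv f t)
    linarith
  have hint : ∫ _ in c..d, (f x ^ 2 - K) ≤ ∫ t in c..d, f t ^ 2 :=
    intervalIntegral.integral_mono_on hcd (by simp)
      (Continuous.intervalIntegrable (by fun_prop) _ _) hpt
  rw [intervalIntegral.integral_const, smul_eq_mul] at hint
  linarith

/-- Each window average is bounded by the supremum of all of them. -/
lemma window_integral_le_iSup {g : ℝ → ℝ} (hg : Continuous g) (hg0 : ∀ t, 0 ≤ g t)
    {a h y : ℝ} (ha : 0 ≤ a) (hh : 0 ≤ h) (hy : y ∈ Set.Icc (-1 : ℝ) 1) :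
    a * ∫ t in (y - h)..(y + h), g t ≤
      ⨆ z ∈ Set.Icc (-1 : ℝ) 1, a * ∫ t in (z - h)..(z + h), g t := by
  have hC : 0 ≤ ∫ t in (-1 - h)..(1 + h), g t :=
    intervalIntegral.integral_nonneg (by linarith) fun t _ => hg0 t
  have hbdd : BddAbove (Set.range fun z : ℝ =>
      ⨆ _ : z ∈ Set.Icc (-1 : ℝ) 1, a * ∫ t in (z - h)..(z + h), g t) := by
    refine ⟨a * ∫ t in (-1 - h)..(1 + h), g t, ?_⟩
    rintro _ ⟨z, rfl⟩
    refine Real.iSup_le (fun hz => ?_) (by positivity)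
    refine mul_le_mul_of_nonneg_left ?_ ha
    exact intervalIntegral.integral_mono_interval (by linarith [hz.1]) (by linarith)
      (by linarith [hz.2]) (Filter.Eventually.of_forall hg0) (hg.intervalIntegrable _ _)
  refine le_trans ?_ (le_ciSup hbdd y)
  rw [ciSup_pos hy]

/-- If the rescaled `H¹` norm is at most `M` and the rescaled window masses are at most `A`, then
`f` is pointwise small on `[-1, 1]`. -/
lemma sq_le_of_window_integral_le {f : ℝ → ℝ} (hf : ContDiff ℝ 1 f) {e r M A δ x : ℝ}
    (he : 0 < e) (hr : 0 < r) (her : 2 * e * r ≤ 1) (hδ : 0 < δ)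
    (hM : e * ∫ t in (-1 : ℝ)..1, deriv f t ^ 2 ≤ M)
    (hA : ∀ y ∈ Set.Icc (-1 : ℝ) 1,
      (1 / e) * ∫ t in (y - 2 * e * r)..(y + 2 * e * r), f t ^ 2 ≤ A)
    (hx : x ∈ Set.Icc (-1 : ℝ) 1) :
    f x ^ 2 ≤ A * (1 / (2 * r) + 1 / δ) + δ * M := by
  have hfc : Continuous f := hf.continuous
  have hdc : Continuous (deriv f) := hf.continuous_deriv le_rfl
  have her0 : 0 < 2 * e * r := by positivity
  obtain ⟨c, hc1, hc2, hxc⟩ : ∃ c, -1 ≤ c ∧ c + 2 * e * r ≤ 1 ∧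
      x ∈ Set.Icc c (c + 2 * e * r) := by
    rcases le_total x 0 with h | h
    · exact ⟨x, hx.1, by linarith, le_rfl, by linarith⟩
    · exact ⟨x - 2 * e * r, by linarith, by linarith [hx.2], by linarith, by linarith⟩
  have hmass : ∫ t in c..(c + 2 * e * r), f t ^ 2 ≤ e * A := by
    have h₁ : ∫ t in c..(c + 2 * e * r), f t ^ 2 ≤
        ∫ t in (x - 2 * e * r)..(x + 2 * e * r), f t ^ 2 :=
      intervalIntegral.integral_mono_interval (by linarith [hxc.2]) (by linarith)
        (by linarith [hxc.1]) (Filter.Eventually.of_forall fun t => sq_nonneg _)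
        (Continuous.intervalIntegrable (by fun_prop) _ _)
    have h₂ := hA x hx
    rw [one_div, inv_mul_le_iff₀ he] at h₂
    exact h₁.trans h₂
  have hderiv : e * ∫ t in c..(c + 2 * e * r), deriv f t ^ 2 ≤ M := by
    refine le_trans (mul_le_mul_of_nonneg_left ?_ he.le) hM
    exact intervalIntegral.integral_mono_interval hc1 (by linarith) hc2
      (Filter.Eventually.of_forall fun t => sq_nonneg _)
      (Continuous.intervalIntegrable (by fun_prop) _ _)
  have key := sq_mul_length_le_of_contDiff hf hxc (inv_pos.2 (mul_pos he hδ))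
  rw [add_sub_cancel_left, inv_inv] at key
  set I := ∫ t in c..(c + 2 * e * r), f t ^ 2
  set J := ∫ t in c..(c + 2 * e * r), deriv f t ^ 2
  have hI : (e * δ)⁻¹ * I ≤ A / δ := by
    calc (e * δ)⁻¹ * I ≤ (e * δ)⁻¹ * (e * A) := by gcongr
      _ = A / δ := by field_simp
  have hJ : e * δ * J ≤ δ * M := by nlinarith
  refine le_of_mul_le_mul_left ?_ her0
  calc 2 * e * r * f x ^ 2 ≤ I + 2 * e * r * ((e * δ)⁻¹ * I + e * δ * J) := key
    _ ≤ e * A + 2 * e * r * (A / δ + δ * M) := by gcongr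
    _ = 2 * e * r * (A * (1 / (2 * r) + 1 / δ) + δ * M) := by field_simp; ring

/-- Interpolation between `L²` and a uniform bound. -/
lemma integral_abs_rpow_le {f : ℝ → ℝ} (hf : Continuous f) {a b s q : ℝ} (hab : a ≤ b)
    (hq : 2 < q) (hs : ∀ t ∈ Set.Icc a b, |f t| ≤ s) :
    ∫ t in a..b, |f t| ^ q ≤ s ^ (q - 2) * ∫ t in a..b, f t ^ 2 := by
  rw [← intervalIntegral.integral_const_mul]
  have hpow : Continuous fun t => |f t| ^ q :=
    hf.abs.rpow_const fun t => Or.inr (by linarith)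
  refine intervalIntegral.integral_mono_on hab (hpow.intervalIntegrable _ _)
    (Continuous.intervalIntegrable (by fun_prop) _ _) fun t ht => ?_
  have hsplit : |f t| ^ q = |f t| ^ (q - 2) * f t ^ 2 := by
    rw [← sq_abs (f t), ← Real.rpow_natCast |f t| 2, ← Real.rpow_add_of_nonneg (abs_nonneg _)
      (by linarith) (by positivity)]
    norm_num
  rw [hsplit]
  exact mul_le_mul_of_nonneg_right
    (Real.rpow_le_rpow (abs_nonneg _) (hs t ht) (by linarith)) (sq_nonneg _)

/-- **Vanishing lemma.** Let `ε_n → 0⁺`, `r > 0`, and let `u_n` be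
`2`-periodic `C¹` functions with rescaled `H¹` norms bounded:
`(1/ε_n)∫_{−1}^{1} (ε_n²|u_n'|² + u_n²/4) ≤ M`. If
`sup_{y ∈ [−1,1]} (1/ε_n)∫_{|t−y| ≤ 2ε_n r} |u_n|² → 0`, then for every `q ∈ (2, ∞)` one
has `(1/ε_n)∫_{−1}^{1} |u_n|^q → 0`. -/
theorem vanishing_lemma (ε : ℕ → ℝ) (hεpos : ∀ n, 0 < ε n)
    (hε : Tendsto ε atTop (𝓝 0)) (r : ℝ) (hr : 0 < r)
    (u : ℕ → ℝ → ℝ) (hu : ∀ n, ContDiff ℝ 1 (u n))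
    (hper : ∀ n, Function.Periodic (u n) 2)
    (M : ℝ) (hM : 0 < M)
    (hbound : ∀ n, (1 / ε n) *
      (∫ t in (-1 : ℝ)..1, (ε n ^ 2 * (deriv (u n) t) ^ 2 + (u n t) ^ 2 / 4)) ≤ M)
    (hvanish : Tendsto
      (fun n => ⨆ y ∈ Set.Icc (-1 : ℝ) 1,
        (1 / ε n) * ∫ t in (y - 2 * ε n * r)..(y + 2 * ε n * r), (u n t) ^ 2)
      atTop (𝓝 0)) :
    ∀ q : ℝ, 2 < q →
      Tendsto (fun n => (1 / ε n) * ∫ t in (-1 : ℝ)..1, |u n t| ^ q) atTop (𝓝 0) := by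
  intro q hq
  have hsplit : ∀ n, ε n * (∫ t in (-1 : ℝ)..1, deriv (u n) t ^ 2) +
      (1 / ε n) * (∫ t in (-1 : ℝ)..1, u n t ^ 2) / 4 ≤ M := by
    intro n
    have hfc : Continuous (u n) := (hu n).continuous
    have hdc : Continuous (deriv (u n)) := (hu n).continuous_deriv le_rfl
    have h := hbound n
    rw [intervalIntegral.integral_add (Continuous.intervalIntegrable (by fun_prop) _ _)
      (Continuous.intervalIntegrable (by fun_prop) _ _), intervalIntegral.integral_const_mul,
      intervalIntegral.integral_div] at h
    have hne := (hεpos n).ne'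
    refine le_of_eq_of_le ?_ h
    field_simp
  have hD0 : ∀ n, 0 ≤ ε n * ∫ t in (-1 : ℝ)..1, deriv (u n) t ^ 2 := fun n =>
    mul_nonneg (hεpos n).le
      (intervalIntegral.integral_nonneg (by norm_num) fun t _ => sq_nonneg _)
  have hU0 : ∀ n, 0 ≤ (1 / ε n) * ∫ t in (-1 : ℝ)..1, u n t ^ 2 := fun n =>
    mul_nonneg (one_div_pos.2 (hεpos n)).le
      (intervalIntegral.integral_nonneg (by norm_num) fun t _ => sq_nonneg _)
  have hunif : ∀ s > 0, ∀ᶠ n in atTop, ∀ t ∈ Set.Icc (-1 : ℝ) 1, |u n t| ≤ s := by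
    intro s hs
    set δ : ℝ := s ^ 2 / (2 * M) with hδdef
    have hδ : 0 < δ := by positivity
    have hlim := hvanish.mul_const (1 / (2 * r) + 1 / δ)
    have hlimε := (hε.const_mul 2).mul_const r
    rw [zero_mul] at hlim
    rw [mul_zero, zero_mul] at hlimε
    filter_upwards [hlim.eventually_lt_const (show 0 < s ^ 2 / 2 by positivity),
      hlimε.eventually_le_const one_pos] with n hn hεn t ht
    have hD : ε n * ∫ t in (-1 : ℝ)..1, deriv (u n) t ^ 2 ≤ M := by
      linarith [hsplit n, hU0 n]
    have hsq := sq_le_of_window_integral_le (hu n) (hεpos n) hr hεn hδ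
      hD
      (fun y hy => window_integral_le_iSup (g := fun t => u n t ^ 2)
        ((hu n).continuous.pow 2) (fun t => sq_nonneg _) (one_div_pos.2 (hεpos n)).le
        (by have := hεpos n; positivity) hy) ht
    have hδM : δ * M = s ^ 2 / 2 := by rw [hδdef]; field_simp
    exact abs_le_of_sq_le_sq (by linarith) hs.le
  refine tendsto_order.2 ⟨fun a ha => Eventually.of_forall fun n => ha.trans_le ?_, fun τ hτ => ?_⟩
  · exact mul_nonneg (one_div_pos.2 (hεpos n)).le (intervalIntegral.integral_nonneg (by norm_num)
      fun t _ => Real.rpow_nonneg (abs_nonneg _) _)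
  have hq2 : 0 < q - 2 := by linarith
  set s : ℝ := (τ / (8 * M)) ^ (q - 2)⁻¹ with hsdef
  have hs : 0 < s := by positivity
  have hspow : s ^ (q - 2) = τ / (8 * M) := Real.rpow_inv_rpow (by positivity) hq2.ne'
  filter_upwards [hunif s hs] with n hn
  calc (1 / ε n) * ∫ t in (-1 : ℝ)..1, |u n t| ^ q
      ≤ (1 / ε n) * (s ^ (q - 2) * ∫ t in (-1 : ℝ)..1, u n t ^ 2) :=
        mul_le_mul_of_nonneg_left
          (integral_abs_rpow_le (hu n).continuous (by norm_num) hq hn)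
          (one_div_pos.2 (hεpos n)).le
    _ = τ / (8 * M) * ((1 / ε n) * ∫ t in (-1 : ℝ)..1, u n t ^ 2) := by rw [hspow]; ring
    _ ≤ τ / (8 * M) * (4 * M) := by
        refine mul_le_mul_of_nonneg_left ?_ (by positivity)
        linarith [hsplit n, hD0 n]
    _ = τ / 2 := by field_simp; norm_num
    _ < τ := half_lt_self hτ
end
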